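/- arXiv:math/9807113 — 15 statements merged into one kernel-verified Lean document; each statement's English description precedes it below -/
import Mathlib

section
/- Let R be a ring, M a finitely generated left R-module, and {N₁, …, N_m} a coindependent family of submodules of M. Then there exists a coindependent family {L₁, …, L_m} of finitely generated submodules of M with L_i ⊆ N_i for each 1 ≤ i ≤ m. -/
universe u v w

section Defs

variable (R : Type u) [Ring R] (M : Type v) [AddCommGroup M] [Module R M]

/-- `N` is a small (superfluous) submodule of `M`: `N + L = M` implies `L = M`. -/
def IsSmallSubmodule (N : Submodule R M) : Prop :=
  ∀ L : Submodule R M, N ⊔ L = ⊤ → L = ⊤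

/-- `N` is small in the submodule `T` (lattice-theoretic version). -/
def IsSmallInSubmodule (T N : Submodule R M) : Prop :=
  ∀ X : Submodule R M, X ≤ T → N ⊔ X = T → X = T

/-- `L` is a weak supplement of `N` in `M`. -/
def IsWeakSupplement (N L : Submodule R M) : Prop :=
  N ⊔ L = ⊤ ∧ IsSmallSubmodule R M (N ⊓ L)

/-- `M` is weakly supplemented. -/
def WeaklySupplemented : Prop :=
  ∀ N : Submodule R M, ∃ L : Submodule R M, IsWeakSupplement R M N L

/-- The radical of `M`: the intersection of all maximal submodules. -/
def moduleRad : Submodule R M :=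
  sInf {N : Submodule R M | IsCoatom N}

/-- `M` is a semilocal module: `M / Rad M` is semisimple. -/
def IsSemilocalModule : Prop :=
  IsSemisimpleModule R (M ⧸ moduleRad R M)

/-- `M` is hollow: nonzero and every proper submodule is small. -/
def IsHollowModule : Prop :=
  Nontrivial M ∧ ∀ N : Submodule R M, N ≠ ⊤ → IsSmallSubmodule R M N

/-- `N` is an essential submodule of `M`. -/
def IsEssentialSubmodule (N : Submodule R M) : Prop :=
  ∀ K : Submodule R M, K ≠ ⊥ → N ⊓ K ≠ ⊥

/-- A witness that `M` has hollow dimension `n`: a small-kernel epimorphism onto a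
direct sum of `n` hollow modules. -/
structure HollowDimWitness (n : ℕ) where
  H : Fin n → Type v
  [hAdd : ∀ i, AddCommGroup (H i)]
  [hMod : ∀ i, Module R (H i)]
  g : M →ₗ[R] ∀ i, H i
  surj : Function.Surjective g
  hollow : ∀ i, IsHollowModule R (H i)
  small : IsSmallSubmodule R M (LinearMap.ker g)

/-- `M` has finite hollow dimension. -/
def HasFiniteHollowDim : Prop := ∃ n : ℕ, Nonempty (HollowDimWitness R M n)

/-- The composition length of `M` is `n`. -/
def ModuleLengthIs (n : ℕ) : Prop :=
  ∃ s : CompositionSeries (Submodule R M), s.head = ⊥ ∧ s.last = ⊤ ∧ s.length = n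

/-- A family of proper submodules is coindependent. -/
def Coindependent {ι : Type w} (K : ι → Submodule R M) : Prop :=
  (∀ i, K i ≠ ⊤) ∧
    ∀ (i : ι) (J : Finset ι), i ∉ J → K i ⊔ (⨅ j ∈ J, K j) = ⊤

end Defs

/-- If `M` is a finitely generated module and `N₁, …, N_m` is a
coindependent family of submodules, then there is a coindependent family of
finitely generated submodules `Lᵢ ⊆ Nᵢ`. -/
theorem coindependent_family_has_fg_refinement
    (R : Type u) [Ring R] (M : Type v) [AddCommGroup M] [Module R M]
    [Module.Finite R M] (m : ℕ) (N : Fin m → Submodule R M)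
    (hN : Coindependent R M N) :
    ∃ L : Fin m → Submodule R M,
      (∀ i, L i ≤ N i) ∧ (∀ i, (L i).FG) ∧ Coindependent R M L := by
  obtain ⟨hne, hsum⟩ := hN
  obtain ⟨S, hS⟩ := (Module.Finite.fg_top : (⊤ : Submodule R M).FG)
  have key : ∀ (i : Fin m) (x : M), ∃ a c : M, a ∈ N i ∧ (∀ j, j ≠ i → c ∈ N j) ∧ a + c = x := by
    intro i x
    have h : x ∈ N i ⊔ ⨅ j ∈ Finset.univ.erase i, N j := by
      rw [hsum i _ (by simp)]
      trivial
    obtain ⟨a, ha, c, hc, hac⟩ := Submodule.mem_sup.1 h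
    refine ⟨a, c, ha, ?_, hac⟩
    intro j hj
    simp only [Submodule.mem_iInf] at hc
    exact hc j (by simp [hj])
  choose a c ha hc hac using key
  let T : Fin m → Set M := fun i =>
    (a i '' (S : Set M)) ∪ ⋃ j ∈ {j : Fin m | j ≠ i}, c j '' (S : Set M)
  have hTfin : ∀ i, (T i).Finite := fun i =>
    (S.finite_toSet.image _).union
      ((Set.toFinite _).biUnion fun j _ => S.finite_toSet.image _)
  have hle : ∀ i, Submodule.span R (T i) ≤ N i := by
    intro i
    rw [Submodule.span_le]
    rintro y (⟨x, -, rfl⟩ | hy)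
    · exact ha i x
    · simp only [Set.mem_iUnion] at hy
      obtain ⟨j, hj, x, -, rfl⟩ := hy
      exact hc j x i (Ne.symm hj)
  refine ⟨fun i => Submodule.span R (T i), hle, fun i => Submodule.fg_span (hTfin i), ?_, ?_⟩
  · intro i h
    exact hne i (top_le_iff.1 (h ▸ hle i))
  · intro i J hiJ
    rw [← top_le_iff, ← hS, Submodule.span_le]
    intro x hx
    rw [← hac i x]
    refine Submodule.add_mem_sup (Submodule.subset_span (Or.inl ⟨x, hx, rfl⟩)) ?_
    simp only [Submodule.mem_iInf]
    intro j hj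
    refine Submodule.subset_span (Or.inr ?_)
    simp only [Set.mem_iUnion]
    refine ⟨i, ?_, x, hx, rfl⟩
    rintro rfl
    exact hiJ hj
end

section
/- For a left R-module M the following are equivalent: (a) M has finite hollow dimension; (b) there exist n ∈ ℕ and a map d from the lattice of submodules of M to {0, 1, …, n} such that (i) d(N) = 0 implies N = M, and (ii) whenever N + L = M one has d(N ∩ L) = d(N) + d(L); (c) there exists a partial ordering ≤ on the set of submodules of M such that (i) this poset is artinian (it has no infinite strictly descending chain), and (ii) for all submodules N, L with N + L = M and L ≠ M one has N > N ∩ L. -/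
universe u v w

section HollowLattice

variable {α : Type*} [Lattice α] [BoundedOrder α]

/-- Meet of a list. -/
def linf : List α → α
  | [] => ⊤
  | K :: l => K ⊓ linf l

/-- Sequentially coindependent lists of proper elements. -/
def OkList : List α → Prop
  | [] => True
  | K :: l => K ≠ ⊤ ∧ K ⊔ linf l = ⊤ ∧ OkList l

/-- The lattice `[K, ⊤]` is hollow. -/
def Hol (K : α) : Prop := K ≠ ⊤ ∧ ∀ A B : α, K ≤ A → K ≤ B → A ⊔ B = ⊤ → A = ⊤ ∨ B = ⊤

/-- `X` is small relative to `N`. -/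
def SmallRel (N X : α) : Prop := ∀ Y, N ≤ Y → X ⊔ Y = ⊤ → Y = ⊤

/-- A list exhibiting finite hollow dimension above `N`. -/
def GoodList (N : α) (l : List α) : Prop :=
  OkList l ∧ (∀ K ∈ l, Hol K) ∧ (∀ K ∈ l, N ≤ K) ∧ SmallRel N (linf l)

/-- The basic descent relation. -/
def Desc (A B : α) : Prop := ∃ L : α, L ≠ ⊤ ∧ B ⊔ L = ⊤ ∧ A = B ⊓ L

lemma linf_append (l m : List α) : linf (l ++ m) = linf l ⊓ linf m := by
  induction l with
  | nil => simp [linf]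
  | cons a l ih => simp [linf, ih, inf_assoc]

lemma le_linf {N : α} {l : List α} (h : ∀ K ∈ l, N ≤ K) : N ≤ linf l := by
  induction l with
  | nil => simp [linf]
  | cons a l ih =>
    simp only [List.mem_cons, forall_eq_or_imp] at h
    exact le_inf h.1 (ih h.2)

lemma linf_le {l : List α} {K : α} (h : K ∈ l) : linf l ≤ K := by
  induction l with
  | nil => simp at h
  | cons a l ih =>
    rcases List.mem_cons.1 h with rfl | h
    · exact inf_le_left
    · exact inf_le_right.trans (ih h)

lemma OkList.sublist {l m : List α} (h : l.Sublist m) (hm : OkList m) : OkList l := by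
  induction h with
  | slnil => trivial
  | cons a h ih => exact ih hm.2.2
  | cons_cons a h ih =>
    refine ⟨hm.1, ?_, ih hm.2.2⟩
    refine top_le_iff.1 (hm.2.1.symm.le.trans (sup_le_sup_left ?_ _))
    exact le_linf fun K hK => linf_le (h.subset hK)

lemma OkList.ne_top {l : List α} (h : OkList l) : ∀ K ∈ l, K ≠ ⊤ := by
  induction l with
  | nil => simp
  | cons a l ih =>
    intro K hK
    rcases List.mem_cons.1 hK with rfl | hK
    · exact h.1
    · exact ih h.2.2 K hK

variable [IsModularLattice α]

/-- Modular law in the shape used below. -/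
lemma modl {a b c : α} (h : a ⊔ b = ⊤) (hc : a ≤ c) : c = a ⊔ (b ⊓ c) := by
  rw [← sup_inf_assoc_of_le b hc, h, top_inf_eq]

lemma exists_drop {K : α} (hK : Hol K) (m : List α) (hm : OkList m) (hne : m ≠ []) :
    ∃ m' : List α, m'.Sublist m ∧ m'.length + 1 = m.length ∧ K ⊔ linf m' = ⊤ := by
  induction m with
  | nil => exact absurd rfl hne
  | cons A m ih =>
    by_cases h0 : m = []
    · subst h0
      exact ⟨[], by simp, by simp, by simp [linf]⟩
    by_cases h1 : K ⊔ linf m = ⊤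
    · exact ⟨m, List.sublist_cons_self _ _, by simp, h1⟩
    obtain ⟨m', hs, hl, hsup⟩ := ih hm.2.2 h0
    refine ⟨A :: m', hs.cons_cons A, by simp [hl], ?_⟩
    have hle : linf m ≤ linf m' := le_linf fun K hK => linf_le (hs.subset hK)
    have e : linf m' = linf m ⊔ (A ⊓ linf m') := modl (by rw [sup_comm]; exact hm.2.1) hle
    have : (K ⊔ A ⊓ linf m') ⊔ (K ⊔ linf m) = ⊤ := by
      rw [eq_top_iff, ← hsup]
      refine sup_le (le_sup_left.trans le_sup_left) ?_
      rw [e]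
      refine sup_le (le_sup_right.trans le_sup_right) ?_
      rw [← e]
      exact le_sup_right.trans le_sup_left
    rcases hK.2 _ _ le_sup_left le_sup_left this with h | h
    · exact h
    · exact absurd h h1

lemma ok_map {W : α} (Φ : α → α) (hmono : Monotone Φ)
    (hne : ∀ A, W ≤ A → Φ A = ⊤ → A = ⊤) 
    (hsup : ∀ A B, W ≤ A → W ≤ B → A ⊔ B = ⊤ → Φ A ⊔ Φ B = ⊤) (m : List α)
    (hW : ∀ A ∈ m, W ≤ A) (hm : OkList m) : OkList (m.map Φ) ∧ Φ (linf m) ≤ linf (m.map Φ) := by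
  induction m with
  | nil => exact ⟨trivial, by simp [linf]⟩
  | cons A m ih =>
    simp only [List.mem_cons, forall_eq_or_imp] at hW
    obtain ⟨i1, i2⟩ := ih hW.2 hm.2.2
    refine ⟨⟨fun h => hm.1 (hne A hW.1 h), ?_, i1⟩, ?_⟩
    · exact top_le_iff.1 ((hsup A _ hW.1 (le_linf hW.2) hm.2.1).symm.le.trans
        (sup_le_sup_left i2 _))
    · exact le_inf (hmono inf_le_left) ((hmono inf_le_right).trans i2)

lemma steinitz (l : List α) (hl : OkList l) (hh : ∀ K ∈ l, Hol K) (m : List α) (hm : OkList m)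
    (hlm : ∀ A ∈ m, linf l ≤ A) : m.length ≤ l.length := by
  induction l generalizing m with
  | nil =>
    cases m with
    | nil => simp
    | cons A m => exact absurd (top_le_iff.1 (hlm A (by simp))) hm.1
  | cons K l ih =>
    by_cases h0 : m = []
    · simp [h0]
    obtain ⟨m', hs, hlen, hK⟩ := exists_drop (hh K (by simp)) m hm h0
    have hok := hm.sublist hs
    have hKC : K ⊔ linf l = ⊤ := hl.2.1
    have o : OkList (m'.map (fun Y => (Y ⊓ K) ⊔ linf l)) := by
     refine (ok_map (W := linf m') (fun Y => (Y ⊓ K) ⊔ linf l)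
      (fun a b hab => sup_le_sup_right (inf_le_inf_right _ hab) _) ?_ ?_ m'
      (fun A hA => linf_le hA) hok).1
     · skip
       intro A hWA hA
       have hXA : linf l ⊓ K ≤ A := by
         have : linf (K :: l) ≤ linf m' := le_linf fun B hB => hlm B (hs.subset hB)
         rw [inf_comm]
         exact this.trans hWA
       have e := modl (c := K) hA inf_le_right
       have hKA : K ≤ A := by
         rw [e]
         exact sup_le inf_le_left hXA
       exact top_le_iff.1 (hK.symm.le.trans (sup_le hKA hWA))
     · intro A B hA hB hAB
       have hK' : linf m' ⊔ K = ⊤ := by rw [sup_comm]; exact hK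
       have eA := modl hK' hA
       have eB := modl hK' hB
       have e1 : (A ⊓ K ⊔ B ⊓ K) ⊔ linf m' = ⊤ := by
         rw [eq_top_iff, ← hAB]
         refine sup_le ?_ ?_
         · rw [eA]
           refine sup_le le_sup_right ?_
           rw [← eA, inf_comm]
           exact le_sup_left.trans le_sup_left
         · rw [eB]
           refine sup_le le_sup_right ?_
           rw [← eB, inf_comm]
           exact le_sup_right.trans le_sup_left
       have e2 := modl (c := K) e1 (sup_le inf_le_right inf_le_right)
       have h3 : K ≤ A ⊓ K ⊔ B ⊓ K := by
         rw [e2]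
         refine sup_le (by rw [← e2]) ?_
         rw [← e2]
         exact (inf_le_inf_right K hA).trans le_sup_left
       rw [eq_top_iff, ← hKC]
       refine sup_le (h3.trans ?_) (le_sup_right.trans le_sup_left)
       exact sup_le_sup le_sup_left le_sup_left
    have := ih hl.2.2 (fun K hK => hh K (by simp [hK])) _ o (by
      intro A hA
      obtain ⟨Y, -, rfl⟩ := List.mem_map.1 hA
      exact le_sup_right)
    simp only [List.length_map] at this
    simp only [List.length_cons]
    omega

lemma GoodList.length_le {N : α} {l m : List α} (h : GoodList N l) (hm : OkList m)
    (hN : ∀ A ∈ m, N ≤ A) : m.length ≤ l.length := by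
  obtain ⟨o1, -⟩ := ok_map (W := N) (fun Y => linf l ⊔ Y)
    (fun a b hab => sup_le_sup_left hab _) (fun A hA hA' => h.2.2.2 A hA hA')
    (fun A B _ _ hAB => by
      rw [eq_top_iff, ← hAB]
      exact sup_le_sup le_sup_right le_sup_right) m hN hm
  have := steinitz l h.1 h.2.1 _ o1 (by
    intro A hA
    obtain ⟨Y, -, rfl⟩ := List.mem_map.1 hA
    exact le_sup_left)
  simpa using this

lemma acc_of_good {l₀ : List α} (h : GoodList ⊥ l₀) : Acc Desc (⊤ : α) := by
  have key : ∀ k : ℕ, ∀ l : List α, OkList l → l₀.length < l.length + k → Acc Desc (linf l) := by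
    intro k
    induction k with
    | zero =>
      intro l hl hk
      have := h.length_le hl (fun _ _ => bot_le)
      omega
    | succ k ih =>
      intro l hl hk
      constructor
      rintro _ ⟨L, hL, hs, rfl⟩
      have := ih (L :: l) ⟨hL, by rw [sup_comm]; exact hs, hl⟩ (by simp; omega)
      rw [inf_comm]
      exact this
  exact key (l₀.length + 1) [] trivial (by simp)

lemma exists_hol {X : α} (hX : Acc Desc X) :
    ∀ B : α, B ≠ ⊤ → X ⊔ B = ⊤ → ∃ K, B ≤ K ∧ Hol K := by
  induction hX with
  | intro X _ ih =>
    intro B hB hXB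
    by_cases hb : Hol B
    · exact ⟨B, le_rfl, hb⟩
    have : ∃ A B', B ≤ A ∧ B ≤ B' ∧ A ⊔ B' = ⊤ ∧ A ≠ ⊤ ∧ B' ≠ ⊤ := by
      by_contra hcon
      refine hb ⟨hB, fun A B' h1 h2 h3 => ?_⟩
      by_contra h4
      push Not at h4
      exact hcon ⟨A, B', h1, h2, h3, h4.1, h4.2⟩
    obtain ⟨A, B', h1, h2, h3, h4, h5⟩ := this
    have hXA : X ⊔ A = ⊤ := top_le_iff.1 (hXB.symm.le.trans (sup_le_sup_left h1 _))
    have e : A = B ⊔ (X ⊓ A) := modl (by rw [sup_comm]; exact hXB) h1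
    obtain ⟨K, hK, hK'⟩ := ih (X ⊓ A) ⟨A, h4, hXA, rfl⟩ B' h5 (by
      rw [eq_top_iff, ← h3]
      refine sup_le ?_ le_sup_right
      rw [e]
      refine sup_le (h2.trans le_sup_right) ?_
      rw [← e]
      exact le_sup_left)
    exact ⟨K, h2.trans hK, hK'⟩

lemma exists_good (hT : Acc Desc (⊤ : α)) (N : α) : ∃ l, GoodList N l := by
  have key : ∀ X : α, Acc Desc X → ∀ l : List α, linf l = X → OkList l → (∀ K ∈ l, Hol K) →
      (∀ K ∈ l, N ≤ K) → ∃ l, GoodList N l := by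
    intro X hX
    induction hX with
    | intro X _ ih =>
      rintro l rfl h1 h2 h3
      by_cases hs : SmallRel N (linf l)
      · exact ⟨l, h1, h2, h3, hs⟩
      unfold SmallRel at hs
      push Not at hs
      obtain ⟨Y, hNY, hY, hYt⟩ := hs
      obtain ⟨K, hYK, hK⟩ := exists_hol hT Y hYt (by simp)
      have hlK : linf l ⊔ K = ⊤ := top_le_iff.1 (hY.symm.le.trans (sup_le_sup_left hYK _))
      refine ih (linf l ⊓ K) ⟨K, hK.1, hlK, rfl⟩ (K :: l) (by simp [linf, inf_comm])
        ⟨hK.1, by rw [sup_comm]; exact hlK, h1⟩ ?_ ?_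
      · simpa using ⟨hK, h2⟩
      · simpa using ⟨hNY.trans hYK, h3⟩
  exact key ⊤ hT [] rfl trivial (by simp) (by simp)

lemma OkList.append {N L : α} (hNL : N ⊔ L = ⊤) {l m : List α} (hl : OkList l) (hm : OkList m)
    (h1 : ∀ K ∈ l, N ≤ K) (h2 : ∀ K ∈ m, L ≤ K) : OkList (l ++ m) := by
  induction l with
  | nil => simpa using hm
  | cons A l ih =>
    simp only [List.mem_cons, forall_eq_or_imp] at h1
    refine ⟨hl.1, ?_, ih hl.2.2 h1.2⟩
    change A ⊔ linf (l ++ m) = ⊤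
    rw [linf_append]
    have hN' : N ⊔ linf m = ⊤ := top_le_iff.1 (hNL.symm.le.trans (sup_le_sup_left (le_linf h2) _))
    have e := modl hN' (le_linf h1.2)
    rw [eq_top_iff, ← hl.2.1]
    refine sup_le le_sup_left ?_
    rw [e]
    refine sup_le (h1.1.trans le_sup_left) ?_
    rw [← e, inf_comm]
    exact le_sup_right

lemma small_aux {N L X Y : α} (hX : SmallRel N X) (hNL : N ⊔ L = ⊤) (hY : N ⊓ L ≤ Y)
    (h : (X ⊓ L) ⊔ Y = ⊤) : Y = ⊤ := by
  have e := modl (c := L) h inf_le_right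
  have h1 : N ⊔ Y ⊓ L = ⊤ := by
    apply hX _ le_sup_left
    rw [eq_top_iff, ← hNL]
    refine sup_le (le_sup_left.trans le_sup_right) ?_
    calc L = X ⊓ L ⊔ Y ⊓ L := e
      _ ≤ _ := sup_le_sup inf_le_left le_sup_right
  have h1' : Y ⊓ L ⊔ N = ⊤ := by rw [sup_comm]; exact h1
  have e2 := modl (c := L) h1' inf_le_right
  have hLY : L ≤ Y := by
    rw [e2]
    exact sup_le inf_le_left hY
  rw [eq_top_iff, ← h]
  exact sup_le (inf_le_right.trans hLY) le_rfl

lemma GoodList.append {N L : α} (hNL : N ⊔ L = ⊤) {l m : List α} (hl : GoodList N l)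
    (hm : GoodList L m) : GoodList (N ⊓ L) (l ++ m) := by
  refine ⟨hl.1.append hNL hm.1 hl.2.2.1 hm.2.2.1, ?_, ?_, ?_⟩
  · intro K hK
    rcases List.mem_append.1 hK with h | h
    · exact hl.2.1 K h
    · exact hm.2.1 K h
  · intro K hK
    rcases List.mem_append.1 hK with h | h
    · exact inf_le_left.trans (hl.2.2.1 K h)
    · exact inf_le_right.trans (hm.2.2.1 K h)
  · intro Y hY h
    rw [linf_append] at h
    have hNX := le_linf hl.2.2.1
    have hLX := le_linf hm.2.2.1
    have e1 : linf m = L ⊔ (N ⊓ linf m) := modl (by rw [sup_comm]; exact hNL) hLX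
    have e2 : linf l ⊓ linf m ≤ (linf m ⊓ N) ⊔ (linf l ⊓ L) := by
      conv_lhs => rw [e1]
      rw [inf_comm (linf l), inf_comm N, sup_comm L, inf_comm (linf l) L,
        sup_inf_assoc_of_le L (inf_le_right.trans hNX)]
    have hLN : L ⊔ N = ⊤ := by rw [sup_comm]; exact hNL
    refine small_aux hl.2.2.2 hNL hY ?_
    refine small_aux hm.2.2.2 hLN (by rw [inf_comm]; exact hY.trans le_sup_right) ?_
    rw [eq_top_iff, ← h, ← sup_assoc]
    exact sup_le_sup_right e2 _

lemma exists_dim {l₀ : List α} (h : GoodList ⊥ l₀) : ∃ (n : ℕ) (d : α → ℕ),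
    (∀ N, d N ≤ n) ∧ (∀ N, d N = 0 → N = ⊤) ∧
    (∀ N L, N ⊔ L = ⊤ → d (N ⊓ L) = d N + d L) := by
  choose f hf using exists_good (acc_of_good h)
  refine ⟨l₀.length, fun N => (f N).length, fun N => h.length_le (hf N).1 fun _ _ => bot_le,
    fun N hN => ?_, fun N L hNL => ?_⟩
  · refine (hf N).2.2.2 N le_rfl ?_
    rw [List.length_eq_zero_iff.1 hN]
    simp [linf]
  · have h1 := (hf N).append hNL (hf L)
    have h2 := hf (N ⊓ L)
    have := h1.length_le h2.1 h2.2.2.1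
    have := h2.length_le h1.1 h1.2.2.1
    simp only [List.length_append] at *
    omega

lemma linf_ofFn {n : ℕ} (K : Fin n → α) (x : α) : x ≤ linf (List.ofFn K) ↔ ∀ i, x ≤ K i := by
  constructor
  · exact fun h i => h.trans (linf_le (by simp [List.mem_ofFn]))
  · intro h
    apply le_linf
    intro A hA
    obtain ⟨i, rfl⟩ := List.mem_ofFn.1 hA
    exact h i

end HollowLattice

section HollowModule

variable {R : Type u} [Ring R] {M : Type v} [AddCommGroup M] [Module R M]

lemma hol_ker {H : Type*} [AddCommGroup H] [Module R H] (hH : IsHollowModule R H)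
    (f : M →ₗ[R] H) (hf : Function.Surjective f) : Hol (LinearMap.ker f) := by
  obtain ⟨hnt, hs⟩ := hH
  refine ⟨fun h => ?_, fun A B hA hB hAB => ?_⟩
  · rw [LinearMap.ker_eq_top] at h
    obtain ⟨y, hy⟩ := exists_ne (0 : H)
    obtain ⟨x, rfl⟩ := hf y
    simp [h] at hy
  · have key : ∀ C : Submodule R M, LinearMap.ker f ≤ C → C.map f = ⊤ → C = ⊤ := by
      intro C hC h
      have := Submodule.comap_map_eq f C
      rw [h, Submodule.comap_top, sup_eq_left.2 hC] at this
      exact this.symm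
    by_cases h : A.map f = ⊤
    · exact Or.inl (key A hA h)
    · right
      apply key B hB
      apply hs _ h
      rw [← Submodule.map_sup, hAB, Submodule.map_top, LinearMap.range_eq_top.2 hf]

lemma hollow_quot {K : Submodule R M} (hK : Hol K) : IsHollowModule R (M ⧸ K) := by
  refine ⟨Submodule.Quotient.nontrivial_iff.2 hK.1, fun N hN L hNL => ?_⟩
  have key : ∀ C : Submodule R (M ⧸ K), C.comap K.mkQ = ⊤ → C = ⊤ := by
    intro C h
    rw [← Submodule.map_comap_eq_of_surjective K.mkQ_surjective C, h, Submodule.map_top,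
      Submodule.range_mkQ]
  have h := hK.2 (N.comap K.mkQ) (L.comap K.mkQ) (Submodule.le_comap_mkQ _ _)
    (Submodule.le_comap_mkQ _ _) (by
      rw [eq_top_iff]
      rintro m -
      have hm : K.mkQ m ∈ N ⊔ L := by rw [hNL]; trivial
      obtain ⟨a, ha, b, hb, hab⟩ := Submodule.mem_sup.1 hm
      obtain ⟨x, rfl⟩ := K.mkQ_surjective a
      refine Submodule.mem_sup.2 ⟨x, ha, m - x, ?_, by simp⟩
      rw [Submodule.mem_comap, map_sub, ← hab, add_sub_cancel_left]
      exact hb)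
  rcases h with h | h
  · exact absurd (key N h) hN
  · exact key L h

lemma ok_ofFn {n : ℕ} (K : Fin n → Submodule R M) (h0 : ∀ i, K i ≠ ⊤)
    (h : ∀ (i : Fin n) (m : M), ∃ x, m - x ∈ K i ∧ ∀ j, j ≠ i → x ∈ K j) :
    OkList (List.ofFn K) := by
  induction n with
  | zero => simp [OkList]
  | succ n ih =>
    rw [List.ofFn_succ]
    refine ⟨h0 0, ?_, ih _ (fun i => h0 _) fun i m => ?_⟩
    · rw [eq_top_iff]
      rintro m -
      obtain ⟨x, hx, hx'⟩ := h 0 m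
      refine Submodule.mem_sup.2 ⟨m - x, hx, x, ?_, by simp⟩
      have : Submodule.span R {x} ≤ linf (List.ofFn fun i => K (Fin.succ i)) := by
        rw [linf_ofFn]
        intro i
        simpa using hx' i.succ (Fin.succ_ne_zero i)
      simpa using this
    · obtain ⟨x, hx, hx'⟩ := h i.succ m
      exact ⟨x, hx, fun j hj => hx' _ (by simpa using hj)⟩

lemma good_of_finite (h : HasFiniteHollowDim R M) :
    ∃ l : List (Submodule R M), GoodList ⊥ l := by
  obtain ⟨n, ⟨w⟩⟩ := h
  obtain ⟨H, g, hg, hh, hs⟩ := w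
  have hsurj : ∀ i, Function.Surjective (LinearMap.proj i ∘ₗ g) := by
    intro i
    rw [LinearMap.coe_comp]
    exact (Function.surjective_eval i).comp hg
  have hol : ∀ i, Hol (LinearMap.ker (LinearMap.proj i ∘ₗ g)) :=
    fun i => hol_ker (hh i) _ (hsurj i)
  refine ⟨List.ofFn fun i => LinearMap.ker (LinearMap.proj i ∘ₗ g), ?_, ?_, ?_, ?_⟩
  · refine ok_ofFn _ (fun i => (hol i).1) fun i m => ?_
    obtain ⟨x, hx⟩ := hg (Pi.single i (g m i))
    refine ⟨x, ?_, fun j hj => ?_⟩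
    · simp [hx]
    · simp [hx, hj]
  · intro K hK
    obtain ⟨i, rfl⟩ := List.mem_ofFn.1 hK
    exact hol i
  · exact fun _ _ => bot_le
  · intro Y _ hY
    apply hs
    rw [eq_top_iff, ← hY]
    refine sup_le_sup_right ?_ _
    intro x hx
    have := (linf_ofFn _ _).1 (le_refl (linf (List.ofFn fun i =>
      LinearMap.ker (LinearMap.proj i ∘ₗ g))))
    rw [LinearMap.mem_ker]
    funext i
    simpa using this i hx

lemma crt_list (l : List (Submodule R M)) (hl : OkList l) (f : Fin l.length → M) :
    ∃ m, ∀ i, m - f i ∈ l.get i := by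
  induction l with
  | nil => exact ⟨0, fun i => i.elim0⟩
  | cons K l ih =>
    obtain ⟨m, hm⟩ := ih hl.2.2 (fun i => f i.succ)
    have : f 0 - m ∈ K ⊔ linf l := by rw [hl.2.1]; trivial
    obtain ⟨k, hk, c, hc, hkc⟩ := Submodule.mem_sup.1 this
    refine ⟨m + c, fun i => ?_⟩
    refine Fin.cases ?_ (fun i => ?_) i
    · have e : m + c - f 0 = -k := by
        rw [← sub_eq_zero]
        have : f 0 = k + c + m := by rw [hkc]; abel
        rw [this]; abel
      change m + c - f 0 ∈ K
      rw [e]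
      exact K.neg_mem hk
    · have e : m + c - f i.succ = (m - f i.succ) + c := by abel
      change m + c - f i.succ ∈ l.get i
      rw [e]
      exact Submodule.add_mem _ (hm i) (linf_le (List.get_mem l i) hc)

lemma finite_of_good {l : List (Submodule R M)} (h : GoodList ⊥ l) : HasFiniteHollowDim R M := by
  refine ⟨l.length, ⟨?_⟩⟩
  refine { H := fun i => M ⧸ l.get i, g := LinearMap.pi fun i => (l.get i).mkQ, surj := ?_,
           hollow := fun i => hollow_quot (h.2.1 _ (List.get_mem l i)), small := ?_ }
  · intro y
    choose f hf using fun i => (l.get i).mkQ_surjective (y i)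
    obtain ⟨m, hm⟩ := crt_list l h.1 f
    refine ⟨m, funext fun i => ?_⟩
    rw [← hf i]
    exact (Submodule.Quotient.eq _).2 (hm i)
  · intro Y hY
    refine h.2.2.2 Y bot_le ?_
    rw [eq_top_iff, ← hY]
    refine sup_le_sup_right ?_ _
    apply le_linf
    intro K hK x hx
    obtain ⟨i, rfl⟩ := List.get_of_mem hK
    have := congrFun (LinearMap.mem_ker.1 hx) i
    exact (Submodule.Quotient.mk_eq_zero _).1 this

end HollowModule

/-- Camps–Dicks type characterization of finite hollow dimension. -/
theorem hasFiniteHollowDim_iff_dimension_function_iff_artinian_order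
    (R : Type u) [Ring R] (M : Type v) [AddCommGroup M] [Module R M] :
    (HasFiniteHollowDim R M ↔
      ∃ (n : ℕ) (d : Submodule R M → ℕ),
        (∀ N : Submodule R M, d N ≤ n) ∧
        (∀ N : Submodule R M, d N = 0 → N = ⊤) ∧
        (∀ N L : Submodule R M, N ⊔ L = ⊤ → d (N ⊓ L) = d N + d L)) ∧
    (HasFiniteHollowDim R M ↔
      ∃ le : Submodule R M → Submodule R M → Prop,
        IsPartialOrder (Submodule R M) le ∧
        WellFounded (fun A B : Submodule R M => le A B ∧ A ≠ B) ∧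
        (∀ N L : Submodule R M, N ⊔ L = ⊤ → L ≠ ⊤ →
          le (N ⊓ L) N ∧ N ⊓ L ≠ N)) := by
  have ab : HasFiniteHollowDim R M → ∃ (n : ℕ) (d : Submodule R M → ℕ),
        (∀ N : Submodule R M, d N ≤ n) ∧
        (∀ N : Submodule R M, d N = 0 → N = ⊤) ∧
        (∀ N L : Submodule R M, N ⊔ L = ⊤ → d (N ⊓ L) = d N + d L) := by
    intro h
    obtain ⟨l, hl⟩ := good_of_finite h
    exact exists_dim hl
  have bc : (∃ (n : ℕ) (d : Submodule R M → ℕ),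
        (∀ N : Submodule R M, d N ≤ n) ∧
        (∀ N : Submodule R M, d N = 0 → N = ⊤) ∧
        (∀ N L : Submodule R M, N ⊔ L = ⊤ → d (N ⊓ L) = d N + d L)) →
      ∃ le : Submodule R M → Submodule R M → Prop,
        IsPartialOrder (Submodule R M) le ∧
        WellFounded (fun A B : Submodule R M => le A B ∧ A ≠ B) ∧
        (∀ N L : Submodule R M, N ⊔ L = ⊤ → L ≠ ⊤ →
          le (N ⊓ L) N ∧ N ⊓ L ≠ N) := by
    rintro ⟨n, d, h1, h2, h3⟩
    refine ⟨fun A B => A = B ∨ d B < d A, ?_, ?_, ?_⟩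
    · exact {
        refl := fun A => Or.inl rfl
        trans := by
          rintro A B C (rfl | h) (rfl | h')
          · exact Or.inl rfl
          · exact Or.inr h'
          · exact Or.inr h
          · exact Or.inr (h'.trans h)
        antisymm := by
          rintro A B (rfl | h) (h' | h')
          · rfl
          · rfl
          · exact h'.symm
          · omega }
    · refine Subrelation.wf (r := InvImage (· < ·) fun A => n - d A) ?_
        (InvImage.wf _ wellFounded_lt)
      rintro A B ⟨rfl | h, hne⟩
      · exact absurd rfl hne
      · have := h1 A
        change n - d A < n - d B
        omega
    · intro N L hNL hL
      have e := h3 N L hNL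
      have hp : d L ≠ 0 := fun h => hL (h2 L h)
      refine ⟨Or.inr (by omega), fun h => ?_⟩
      rw [h] at e
      omega
  have ca : (∃ le : Submodule R M → Submodule R M → Prop,
        IsPartialOrder (Submodule R M) le ∧
        WellFounded (fun A B : Submodule R M => le A B ∧ A ≠ B) ∧
        (∀ N L : Submodule R M, N ⊔ L = ⊤ → L ≠ ⊤ →
          le (N ⊓ L) N ∧ N ⊓ L ≠ N)) → HasFiniteHollowDim R M := by
    rintro ⟨le, -, hwf, h⟩
    have hD : WellFounded (Desc (α := Submodule R M)) := by
      refine Subrelation.wf ?_ hwf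
      rintro A B ⟨L, hL, hs, rfl⟩
      exact h B L hs hL
    obtain ⟨l, hl⟩ := exists_good (hD.apply ⊤) ⊥
    exact finite_of_good hl
  exact ⟨⟨ab, fun h => ca (bc h)⟩, ⟨fun h => bc (ab h), ca⟩⟩
end

section
/- Let M be a left R-module and N a proper submodule of M. The following are equivalent: (a) M/N is semisimple; (b) for every submodule L ⊆ M there exists a submodule K ⊆ M such that L + K = M and L ∩ K ⊆ N; (c) there is a direct sum decomposition M = M₁ ⊕ M₂ such that M₁ is semisimple, N is an essential submodule of M₂, and M₂/N is semisimple. -/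
universe u v w

theorem aux_supp {R : Type u} [Ring R] {M : Type v} [AddCommGroup M] [Module R M]
    (N : Submodule R M) (h : IsSemisimpleModule R (M ⧸ N)) (L : Submodule R M) :
    ∃ K : Submodule R M, N ≤ K ∧ L ⊔ K = ⊤ ∧ L ⊓ K ≤ N := by
  obtain ⟨C, hC⟩ := exists_isCompl (L.map N.mkQ)
  refine ⟨C.comap N.mkQ, ?_, ?_, ?_⟩
  · intro x hx
    have : N.mkQ x = 0 := by simpa using hx
    rw [Submodule.mem_comap, this]
    exact C.zero_mem
  · rw [eq_top_iff]
    intro x _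
    have hx : N.mkQ x ∈ L.map N.mkQ ⊔ C := by rw [hC.sup_eq_top]; trivial
    obtain ⟨y, ⟨l, hl, rfl⟩, c, hc, hyc⟩ := Submodule.mem_sup.1 hx
    refine Submodule.mem_sup.2 ⟨l, hl, x - l, ?_, by abel⟩
    rw [Submodule.mem_comap, map_sub, ← hyc]
    simpa using hc
  · rintro x ⟨hx, hx'⟩
    have : N.mkQ x ∈ L.map N.mkQ ⊓ C := ⟨⟨x, hx, rfl⟩, hx'⟩
    rw [hC.inf_eq_bot] at this
    simpa using this

/-- For a proper submodule `N ⊂ M`: `M/N` is semisimple iff every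
submodule has a "supplement mod `N`" iff `M` decomposes as `M₁ ⊕ M₂` with `M₁`
semisimple, `N` essential in `M₂` and `M₂/N` semisimple. -/
theorem semisimple_quotient_characterizations
    (R : Type u) [Ring R] (M : Type v) [AddCommGroup M] [Module R M]
    (N : Submodule R M) (hN : N ≠ ⊤) :
    (IsSemisimpleModule R (M ⧸ N) ↔
      ∀ L : Submodule R M, ∃ K : Submodule R M, L ⊔ K = ⊤ ∧ L ⊓ K ≤ N) ∧
    (IsSemisimpleModule R (M ⧸ N) ↔
      ∃ M₁ M₂ : Submodule R M, IsCompl M₁ M₂ ∧ IsSemisimpleModule R ↥M₁ ∧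
        N ≤ M₂ ∧ (∀ K : Submodule R M, K ≤ M₂ → K ≠ ⊥ → N ⊓ K ≠ ⊥) ∧
        IsSemisimpleModule R (↥M₂ ⧸ N.comap M₂.subtype)) := by
  refine ⟨⟨fun h L => ?_, fun h => ?_⟩, ⟨fun h => ?_, ?_⟩⟩
  · obtain ⟨K, _, h1, h2⟩ := aux_supp N h L
    exact ⟨K, h1, h2⟩
  · refine { exists_isCompl := fun C => ?_ }
    obtain ⟨K, h1, h2⟩ := h (C.comap N.mkQ)
    refine ⟨K.map N.mkQ, IsCompl.of_eq ?_ ?_⟩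
    · rw [eq_bot_iff]
      rintro _ ⟨hx, ⟨k, hk, rfl⟩⟩
      have : k ∈ N := h2 ⟨hx, hk⟩
      simpa using this
    · have h3 : (C.comap N.mkQ).map N.mkQ = C :=
        Submodule.map_comap_eq_of_surjective N.mkQ_surjective C
      rw [← h3, ← Submodule.map_sup, h1, Submodule.map_top, Submodule.range_mkQ]
  · obtain ⟨M₁, hd, hmax⟩ := zorn_le₀ {A : Submodule R M | Disjoint N A} (by
      intro c hc hch
      exact ⟨sSup c, (hch.directedOn.disjoint_sSup_right).2 fun b hb => hc hb,
        fun z hz => le_sSup hz⟩)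
    have hd : Disjoint N M₁ := hd
    obtain ⟨M₂, hNM, h1, h2⟩ := aux_supp N h M₁
    have hbot : M₁ ⊓ M₂ = ⊥ := by
      rw [eq_bot_iff, ← hd.eq_bot]
      exact le_inf h2 inf_le_left
    refine ⟨M₁, M₂, IsCompl.of_eq hbot h1, ?_, hNM, ?_, ?_⟩
    · refine IsSemisimpleModule.of_injective (N.mkQ.comp M₁.subtype) ?_
      rw [injective_iff_map_eq_zero]
      rintro ⟨a, ha⟩ h0
      have haN : a ∈ N := by simpa using h0
      have : a ∈ N ⊓ M₁ := ⟨haN, ha⟩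
      rw [hd.eq_bot] at this
      simpa using this
    · intro K hK hK0 hNK
      apply hK0
      have h3 : (M₁ ⊔ K) ⊓ M₂ = K := by
        rw [sup_comm, sup_inf_assoc_of_le _ hK, hbot, sup_bot_eq]
      have h4 : Disjoint N (M₁ ⊔ K) := by
        rw [disjoint_iff_inf_le, ← hNK]
        refine le_inf inf_le_left ?_
        calc N ⊓ (M₁ ⊔ K) ≤ (M₁ ⊔ K) ⊓ M₂ := le_inf inf_le_right (inf_le_left.trans hNM)
          _ = K := h3
          _ ≤ K := le_rfl
      have h5 : M₁ ⊔ K ≤ M₁ := hmax h4 le_sup_left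
      rw [eq_bot_iff, ← hbot]
      exact le_inf (le_sup_right.trans h5) hK
    · refine IsSemisimpleModule.of_injective
        (Submodule.mapQ (N.comap M₂.subtype) N M₂.subtype le_rfl) ?_
      rw [injective_iff_map_eq_zero]
      intro x h0
      obtain ⟨⟨b, hb⟩, rfl⟩ := Submodule.mkQ_surjective _ x
      have hbN : b ∈ N := by simpa using h0
      simpa using hbN
  · rintro ⟨M₁, M₂, hc, hs1, hNM, -, hs2⟩
    let f := N.mkQ.comp M₁.subtype
    let g := Submodule.mapQ (N.comap M₂.subtype) N M₂.subtype le_rfl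
    have hf := IsSemisimpleModule.range f
    have hg := IsSemisimpleModule.range g
    have hsup := IsSemisimpleModule.sup hf hg
    have htop : LinearMap.range f ⊔ LinearMap.range g = ⊤ := by
      rw [eq_top_iff]
      intro x _
      obtain ⟨m, rfl⟩ := N.mkQ_surjective x
      have hm : m ∈ M₁ ⊔ M₂ := by rw [hc.sup_eq_top]; trivial
      obtain ⟨a, ha, b, hb, rfl⟩ := Submodule.mem_sup.1 hm
      rw [map_add]
      exact Submodule.add_mem_sup ⟨⟨a, ha⟩, rfl⟩ ⟨Submodule.Quotient.mk ⟨b, hb⟩, rfl⟩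
    rw [htop] at hsup
    exact IsSemisimpleModule.congr Submodule.topEquiv.symm
end

section
/- Let M be a weakly supplemented left R-module. Then (1) M is semilocal, i.e. M/Rad(M) is semisimple; and (2) M admits a decomposition M = M₁ ⊕ M₂ where M₁ is semisimple, M₂ is semilocal, and Rad(M) is an essential submodule of M₂. -/
universe u v w

theorem small_le_rad_aux (R : Type u) [Ring R] (M : Type v) [AddCommGroup M] [Module R M]
    (N : Submodule R M) (hN : IsSmallSubmodule R M N) : N ≤ moduleRad R M := by
  refine le_sInf fun C hC => ?_
  by_contra hle
  have hC' : IsCoatom C := hC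
  refine hC'.1 (hN C ?_)
  rw [sup_comm]
  exact hC'.2 _ (lt_of_le_of_ne le_sup_left fun e => hle (e ▸ le_sup_right))

theorem semilocal_aux (R : Type u) [Ring R] (M : Type v) [AddCommGroup M] [Module R M]
    (h : WeaklySupplemented R M) (N : Submodule R M) (hJN : moduleRad R M ≤ N) :
    ∃ L, moduleRad R M ≤ L ∧ N ⊔ L = ⊤ ∧ N ⊓ L = moduleRad R M := by
  obtain ⟨L, h1, h2⟩ := h N
  refine ⟨L ⊔ moduleRad R M, le_sup_right, ?_, ?_⟩
  · rw [← sup_assoc, h1, top_sup_eq]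
  · rw [inf_comm, sup_comm, sup_inf_assoc_of_le _ hJN, inf_comm]
    exact sup_eq_left.2 (small_le_rad_aux R M _ h2)

/-- A weakly supplemented module is semilocal and decomposes as
`M₁ ⊕ M₂` with `M₁` semisimple, `M₂` semilocal and `Rad M` essential in `M₂`. -/
theorem weaklySupplemented_semilocal_and_decomposition
    (R : Type u) [Ring R] (M : Type v) [AddCommGroup M] [Module R M]
    (h : WeaklySupplemented R M) :
    IsSemilocalModule R M ∧
    ∃ M₁ M₂ : Submodule R M, IsCompl M₁ M₂ ∧ IsSemisimpleModule R ↥M₁ ∧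
      IsSemilocalModule R ↥M₂ ∧ moduleRad R M ≤ M₂ ∧
      (∀ K : Submodule R M, K ≤ M₂ → K ≠ ⊥ → moduleRad R M ⊓ K ≠ ⊥) := by
  have hs : ∀ N : Submodule R M, moduleRad R M ≤ N →
      ∃ L, moduleRad R M ≤ L ∧ N ⊔ L = ⊤ ∧ N ⊓ L = moduleRad R M := semilocal_aux R M h
  have hsl : IsSemisimpleModule R (M ⧸ moduleRad R M) := by
    refine (isSemisimpleModule_iff R (M ⧸ moduleRad R M)).2 ⟨fun N => ?_⟩
    have hsurj := Submodule.mkQ_surjective (moduleRad R M)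
    obtain ⟨L, hL, h1, h2⟩ := hs (N.comap (moduleRad R M).mkQ) (Submodule.le_comap_mkQ _ _)
    have hcm : (L.map (moduleRad R M).mkQ).comap (moduleRad R M).mkQ = L := by
      rw [Submodule.comap_map_mkQ, sup_eq_right.2 hL]
    refine ⟨L.map (moduleRad R M).mkQ, ?_, ?_⟩
    · rw [disjoint_iff]
      apply Submodule.comap_injective_of_surjective hsurj
      rw [Submodule.comap_inf, hcm, h2, Submodule.comap_bot, Submodule.ker_mkQ]
    · rw [codisjoint_iff, ← Submodule.map_comap_eq_of_surjective hsurj N, ← Submodule.map_sup, h1,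
        Submodule.map_top, Submodule.range_mkQ]
  refine ⟨hsl, ?_⟩
  obtain ⟨M₁, -, hM₁⟩ := zorn_le_nonempty₀ {X : Submodule R M | Disjoint X (moduleRad R M)}
    (fun c hc hch y hy => ⟨sSup c, by
      have hd : DirectedOn (· ≤ ·) c := hch.directedOn
      exact hd.disjoint_sSup_left.2 fun a ha => hc ha, fun z hz => le_sSup hz⟩)
    ⊥ disjoint_bot_left
  have hd : Disjoint M₁ (moduleRad R M) := hM₁.prop
  obtain ⟨M₂, hJ, h1, h2⟩ := hs (M₁ ⊔ moduleRad R M) le_sup_right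
  have hc : IsCompl M₁ M₂ := by
    constructor
    · rw [disjoint_iff, ← le_bot_iff, ← hd.eq_bot]
      exact le_inf inf_le_left (h2 ▸ inf_le_inf_right _ le_sup_left)
    · rw [codisjoint_iff, ← h1, sup_assoc, sup_eq_right.2 hJ]
  refine ⟨M₁, M₂, hc, ?_, ?_, hJ, ?_⟩
  · refine IsSemisimpleModule.of_injective ((moduleRad R M).mkQ ∘ₗ M₁.subtype) ?_
    rw [← LinearMap.ker_eq_bot, LinearMap.ker_comp, Submodule.ker_mkQ]
    exact Submodule.disjoint_iff_comap_eq_bot.1 hd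
  · let f : M →ₗ[R] (M₂ ⧸ moduleRad R M₂) :=
      (moduleRad R M₂).mkQ ∘ₗ M₂.projectionOnto M₁ hc.symm
    have hf : Function.Surjective f :=
      (Submodule.mkQ_surjective _).comp (Submodule.projectionOnto_surjective hc.symm)
    have hk : moduleRad R M ≤ LinearMap.ker f := by
      rw [LinearMap.ker_comp, Submodule.ker_mkQ]
      exact Module.le_comap_jacobson _
    refine IsSemisimpleModule.of_surjective ((moduleRad R M).liftQ f hk) ?_
    rw [← LinearMap.range_eq_top, Submodule.range_liftQ, LinearMap.range_eq_top]
    exact hf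
  · intro K hK hK0 hJK
    have hm : Disjoint (M₁ ⊔ K) (moduleRad R M) := by
      rw [disjoint_iff, ← le_bot_iff, ← hJK]
      refine le_inf inf_le_right ?_
      calc (M₁ ⊔ K) ⊓ moduleRad R M ≤ (K ⊔ M₁) ⊓ M₂ := by
            rw [sup_comm]; exact inf_le_inf_left _ hJ
        _ = K ⊔ M₁ ⊓ M₂ := sup_inf_assoc_of_le _ hK
        _ = K := by rw [hc.inf_eq_bot, sup_bot_eq]
    have hKM : K ≤ M₁ := le_sup_right.trans (hM₁.le_of_ge hm le_sup_left)
    exact hK0 (le_bot_iff.1 (hc.inf_eq_bot ▸ le_inf hKM hK))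
end

section
/- Any small cover of a weakly supplemented left R-module is weakly supplemented: if f : N → M is an epimorphism of left R-modules with ker(f) small in N and M is weakly supplemented, then N is weakly supplemented. -/
universe u v w

/-- A small cover of a weakly supplemented module is weakly
supplemented. -/
theorem weaklySupplemented_of_small_cover
    (R : Type u) [Ring R] (M : Type v) [AddCommGroup M] [Module R M]
    (N : Type w) [AddCommGroup N] [Module R N]
    (f : N →ₗ[R] M) (hf : Function.Surjective f)
    (hker : IsSmallSubmodule R N (LinearMap.ker f))
    (h : WeaklySupplemented R M) :
    WeaklySupplemented R N := by
  have key : ∀ X : Submodule R N, X.map f = ⊤ → X = ⊤ := by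
    intro X hX
    apply hker
    rw [sup_comm, ← Submodule.comap_map_eq, hX, Submodule.comap_top]
  intro K
  obtain ⟨L, hL, hs⟩ := h (K.map f)
  refine ⟨L.comap f, ?_, ?_⟩
  · apply key
    rw [Submodule.map_sup, Submodule.map_comap_eq_of_surjective hf, hL]
  · intro X hX
    apply key
    apply hs
    rw [eq_top_iff]
    have h1 : (⊤ : Submodule R M) = (K ⊓ L.comap f).map f ⊔ X.map f := by
      rw [← Submodule.map_sup, hX, Submodule.map_top, LinearMap.range_eq_top.2 hf]
    rw [h1]
    refine sup_le_sup_right (le_inf (Submodule.map_mono inf_le_left) ?_) _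
    exact (Submodule.map_mono inf_le_right).trans (Submodule.map_comap_le f L)
end

section
/- Let M be a weakly supplemented left R-module. Then every supplement submodule of M is weakly supplemented, and in particular every direct summand of M is weakly supplemented. -/
universe u v w

/-- Every supplement submodule, and in particular every direct
summand, of a weakly supplemented module is weakly supplemented. -/
theorem weaklySupplemented_supplements_and_summands
    (R : Type u) [Ring R] (M : Type v) [AddCommGroup M] [Module R M]
    (h : WeaklySupplemented R M) :
    (∀ L K : Submodule R M, K ⊔ L = ⊤ → IsSmallInSubmodule R M L (K ⊓ L) →
      WeaklySupplemented R ↥L) ∧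
    (∀ L K : Submodule R M, IsCompl L K → WeaklySupplemented R ↥L) := by
  have main : ∀ L K : Submodule R M, K ⊔ L = ⊤ → IsSmallInSubmodule R M L (K ⊓ L) →
      WeaklySupplemented R ↥L := by
    intro L K hKL hs N
    obtain ⟨X, hX, hXs⟩ := h (N.map L.subtype)
    have hNL : N.map L.subtype ≤ L := Submodule.map_subtype_le L N
    have inj : Function.Injective (Submodule.map L.subtype) :=
      Submodule.map_injective_of_injective L.injective_subtype
    have htop : Submodule.map L.subtype ⊤ = L := Submodule.map_subtype_top L
    refine ⟨X.comap L.subtype, ?_, ?_⟩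
    · apply inj
      rw [Submodule.map_sup, htop, Submodule.map_comap_subtype, inf_comm,
        ← sup_inf_assoc_of_le X hNL, hX, top_inf_eq]
    · intro Y hY
      have hYL : Y.map L.subtype ≤ L := Submodule.map_subtype_le L Y
      have h1 := congrArg (Submodule.map L.subtype) hY
      rw [Submodule.map_sup, htop] at h1
      have h2 : Submodule.map L.subtype (N ⊓ X.comap L.subtype) ≤ N.map L.subtype ⊓ X :=
        le_inf (Submodule.map_mono inf_le_left)
          ((Submodule.map_mono inf_le_right).trans (Submodule.map_comap_le _ _))
      have h3 : Y.map L.subtype ⊔ K = ⊤ := by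
        apply hXs
        rw [eq_top_iff, ← hKL]
        refine sup_le (le_sup_right.trans le_sup_right) ?_
        calc L = _ := h1.symm
          _ ≤ _ := sup_le_sup h2 le_sup_left
      apply inj
      rw [htop]
      apply hs _ hYL
      rw [sup_comm, ← sup_inf_assoc_of_le K hYL, h3, top_inf_eq]
  refine ⟨main, fun L K hc => main L K hc.symm.sup_eq_top ?_⟩
  intro X _ hX
  rwa [hc.symm.inf_eq_bot, bot_sup_eq] at hX
end

section
/- A left R-module M with Rad(M) = 0 is weakly supplemented if and only if M is semisimple. Moreover, a semisimple module M has finite hollow dimension if and only if it has finite length, and in that case hdim(M) = length(M). -/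
universe u v w

theorem small_eq_bot_of_semisimple (R : Type u) [Ring R] (M : Type v) [AddCommGroup M]
    [Module R M] [IsSemisimpleModule R M] (N : Submodule R M) (h : IsSmallSubmodule R M N) :
    N = ⊥ := by
  obtain ⟨L, hL⟩ := exists_isCompl N
  have := h L hL.sup_eq_top
  have h2 := hL.inf_eq_bot
  rwa [this, inf_top_eq] at h2

theorem small_le_rad (R : Type u) [Ring R] (M : Type v) [AddCommGroup M]
    [Module R M] (N : Submodule R M) (h : IsSmallSubmodule R M N) :
    N ≤ moduleRad R M := by
  refine le_sInf fun K hK => ?_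
  by_contra hn
  refine hK.1 (h K ?_)
  exact hK.2 _ (right_lt_sup.mpr hn)

theorem small_bot (R : Type u) [Ring R] (M : Type v) [AddCommGroup M]
    [Module R M] : IsSmallSubmodule R M ⊥ := by
  intro L h
  rwa [bot_sup_eq] at h

theorem hollow_simple (R : Type u) [Ring R] (M : Type v) [AddCommGroup M]
    [Module R M] [IsSemisimpleModule R M] (h : IsHollowModule R M) : IsSimpleModule R M := by
  have := h.1
  rw [isSimpleModule_iff]
  exact { eq_bot_or_eq_top := fun N => by
            by_cases hN : N = ⊤
            · exact Or.inr hN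
            · exact Or.inl (small_eq_bot_of_semisimple R M N (h.2 N hN)) }

theorem simple_hollow (R : Type u) [Ring R] (M : Type v) [AddCommGroup M]
    [Module R M] [IsSimpleModule R M] : IsHollowModule R M := by
  refine ⟨IsSimpleModule.nontrivial R M, fun N hN => ?_⟩
  rw [(eq_bot_or_eq_top N).resolve_right hN]
  exact small_bot R M

theorem witness_length (R : Type u) [Ring R] (M : Type v) [AddCommGroup M]
    [Module R M] [IsSemisimpleModule R M] (n : ℕ) (w : HollowDimWitness R M n) :
    Module.length R M = n := by
  obtain ⟨H, g, surj, hollow, small⟩ := w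
  have hk := small_eq_bot_of_semisimple R M _ small
  let e : M ≃ₗ[R] ∀ i, H i := LinearEquiv.ofBijective g ⟨LinearMap.ker_eq_bot.mp hk, surj⟩
  have hs : ∀ i, IsSimpleModule R (H i) := fun i => by
    have : IsSemisimpleModule R (H i) :=
      IsSemisimpleModule.of_surjective ((LinearMap.proj i : (∀ i, H i) →ₗ[R] H i) ∘ₗ g)
        ((Function.surjective_eval i).comp surj)
    exact hollow_simple R _ (hollow i)
  rw [e.length_eq, Module.length_pi_of_fintype]
  simp [Module.length_eq_one]

/-- A module with zero radical is weakly supplemented iff it is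
semisimple; a semisimple module has finite hollow dimension iff it has finite
length, and then `hdim M = length M`. -/
theorem radZero_weaklySupplemented_iff_semisimple_and_hdim_eq_length
    (R : Type u) [Ring R] (M : Type v) [AddCommGroup M] [Module R M] :
    (moduleRad R M = ⊥ → (WeaklySupplemented R M ↔ IsSemisimpleModule R M)) ∧
    (IsSemisimpleModule R M →
      (HasFiniteHollowDim R M ↔ IsFiniteLength R M) ∧
      ∀ n : ℕ, Nonempty (HollowDimWitness R M n) → ModuleLengthIs R M n) := by
  refine ⟨fun hr => ⟨fun hw => ?_, fun hs N => ?_⟩, fun hs => ⟨⟨?_, fun hf => ?_⟩, ?_⟩⟩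
  · rw [isSemisimpleModule_iff]
    refine ⟨fun N => ?_⟩
    obtain ⟨L, h1, h2⟩ := hw N
    exact ⟨L, disjoint_iff.mpr (le_bot_iff.mp (hr ▸ small_le_rad R M _ h2)), codisjoint_iff.mpr h1⟩
  · obtain ⟨L, hL⟩ := exists_isCompl N
    refine ⟨L, hL.sup_eq_top, ?_⟩
    rw [hL.inf_eq_bot]
    exact small_bot R M
  · rintro ⟨n, ⟨w⟩⟩
    rw [← Module.length_ne_top_iff, witness_length R M n w]
    simp
  · have := (isFiniteLength_iff_isNoetherian_isArtinian.mp hf).1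
    obtain ⟨n, S, e, h⟩ := IsSemisimpleModule.exists_linearEquiv_fin_dfinsupp R M
    let e' := e.trans (DFinsupp.linearEquivFunOnFintype (R := R) (M := fun i => S i))
    refine ⟨n, ⟨{ H := fun i => S i, g := e'.toLinearMap, surj := e'.surjective, hollow := fun i => ?_, small := ?_ }⟩⟩
    · have := h i
      exact simple_hollow R (S i)
    · rw [LinearEquiv.ker]
      exact small_bot R M
  · rintro n ⟨w⟩
    have hl := witness_length R M n w
    have hf : IsFiniteLength R M := by
      rw [← Module.length_ne_top_iff, hl]; simp
    obtain ⟨s, h1, h2⟩ := isFiniteLength_iff_exists_compositionSeries.mp hf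
    refine ⟨s, h1, h2, ?_⟩
    have := Module.length_compositionSeries s h1 h2
    rw [hl] at this
    exact_mod_cast this
end

section
/- Let M be a left R-module with submodules K and M₁. If M₁ is weakly supplemented and the submodule M₁ + K has a weak supplement in M, then K has a weak supplement in M. (Indeed, if N is a weak supplement of M₁ + K in M and L ⊆ M₁ is a weak supplement of (K + N) ∩ M₁ in M₁, then N + L is a weak supplement of K in M.) -/
universe u v w

/-- If `M₁` is weakly supplemented and `M₁ + K` has a weak
supplement in `M`, then `K` has a weak supplement in `M`; indeed if `N` is a weak
supplement of `M₁ + K` in `M` and `L ⊆ M₁` a weak supplement of `(K + N) ∩ M₁` in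
`M₁`, then `N + L` is a weak supplement of `K` in `M`. -/
theorem weak_supplement_of_sum
    (R : Type u) [Ring R] (M : Type v) [AddCommGroup M] [Module R M]
    (K M₁ : Submodule R M) (h1 : WeaklySupplemented R ↥M₁)
    (h2 : ∃ X : Submodule R M, IsWeakSupplement R M (M₁ ⊔ K) X) :
    (∃ L : Submodule R M, IsWeakSupplement R M K L) ∧
    ∀ N : Submodule R M, IsWeakSupplement R M (M₁ ⊔ K) N →
      ∀ L : Submodule R M, L ≤ M₁ →
        ((K ⊔ N) ⊓ M₁) ⊔ L = M₁ →
        IsSmallInSubmodule R M M₁ (((K ⊔ N) ⊓ M₁) ⊓ L) →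
        IsWeakSupplement R M K (N ⊔ L) := by
  have main : ∀ N : Submodule R M, IsWeakSupplement R M (M₁ ⊔ K) N →
      ∀ L : Submodule R M, L ≤ M₁ →
        ((K ⊔ N) ⊓ M₁) ⊔ L = M₁ →
        IsSmallInSubmodule R M M₁ (((K ⊔ N) ⊓ M₁) ⊓ L) →
        IsWeakSupplement R M K (N ⊔ L) := by
    rintro N ⟨hN1, hN2⟩ L hL hs hsm
    refine ⟨?_, ?_⟩
    · rw [eq_top_iff, ← hN1]
      refine sup_le (sup_le ?_ le_sup_left) (le_sup_left.trans le_sup_right)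
      rw [← hs]
      exact sup_le (inf_le_left.trans (sup_le_sup_left le_sup_left _))
        (le_sup_right.trans le_sup_right)
    · intro X hX
      have hle : K ⊓ (N ⊔ L) ≤ ((M₁ ⊔ K) ⊓ N) ⊔ (((K ⊔ N) ⊓ M₁) ⊓ L) := by
        rintro x ⟨hxK, hx⟩
        obtain ⟨n, hn, l, hl, rfl⟩ := Submodule.mem_sup.1 hx
        refine Submodule.add_mem_sup ⟨?_, hn⟩ ⟨⟨?_, hL hl⟩, hl⟩
        · have h := Submodule.add_mem_sup (M₁.neg_mem (hL hl)) hxK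
          have e : -l + (n + l) = n := by abel
          rwa [e] at h
        · have h := Submodule.add_mem_sup hxK (N.neg_mem hn)
          have e : n + l + -n = l := by abel
          rwa [e] at h
      have h3 : ((M₁ ⊔ K) ⊓ N) ⊔ ((((K ⊔ N) ⊓ M₁) ⊓ L) ⊔ X) = ⊤ := by
        rw [← sup_assoc, eq_top_iff, ← hX]
        exact sup_le_sup_right hle X
      have h4 := hN2 _ h3
      have hS : ((K ⊔ N) ⊓ M₁) ⊓ L ≤ M₁ := inf_le_right.trans hL
      have h5 := hsm (X ⊓ M₁) inf_le_right (by
        rw [← sup_inf_assoc_of_le X hS, h4, top_inf_eq])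
      have h6 : M₁ ≤ X := inf_eq_right.1 h5
      rwa [sup_eq_right.2 (hS.trans h6)] at h4
  refine ⟨?_, main⟩
  obtain ⟨N, hN⟩ := h2
  obtain ⟨L, hL1, hL2⟩ := h1 ((K ⊔ N).comap M₁.subtype)
  have hm : (K ⊔ N) ⊓ M₁ = ((K ⊔ N).comap M₁.subtype).map M₁.subtype := by
    rw [Submodule.map_comap_subtype, inf_comm]
  refine ⟨_, main N hN (L.map M₁.subtype) (Submodule.map_subtype_le _ _) ?_ ?_⟩
  · rw [hm, ← Submodule.map_sup, hL1, Submodule.map_subtype_top]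
  · intro X hX h
    rw [hm, ← Submodule.map_inf _ M₁.subtype_injective] at h
    have hXm : X = (X.comap M₁.subtype).map M₁.subtype := by
      rw [Submodule.map_comap_subtype, inf_eq_right.2 hX]
    rw [hXm, ← Submodule.map_sup] at h
    have h7 := hL2 (X.comap M₁.subtype) (by
      apply Submodule.map_injective_of_injective M₁.subtype_injective
      rw [h, Submodule.map_subtype_top])
    rw [hXm, h7, Submodule.map_subtype_top]
end

section
/- If a left R-module M is a finite sum M = M₁ + ⋯ + Mₙ of weakly supplemented submodules M₁, …, Mₙ, then M is weakly supplemented. In particular the sum of two weakly supplemented submodules is weakly supplemented. -/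
universe u v w

section Helpers

variable {R : Type u} [Ring R] {M : Type v} [AddCommGroup M] [Module R M]

theorem small_map_subtype (K : Submodule R M) (A : Submodule R K)
    (hA : IsSmallSubmodule R K A) : IsSmallSubmodule R M (A.map K.subtype) := by
  intro L hL
  have h1 : L.comap K.subtype = ⊤ := by
    apply hA
    rw [eq_top_iff]
    rintro ⟨k, hk⟩ -
    have hk' : k ∈ A.map K.subtype ⊔ L := hL ▸ Submodule.mem_top
    obtain ⟨a, ha, l, hl, hal⟩ := Submodule.mem_sup.1 hk'
    obtain ⟨a', ha', rfl⟩ := ha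
    refine Submodule.mem_sup.2 ⟨a', ha', ⟨k, hk⟩ - a', ?_, by abel⟩
    have : k - (a' : M) = l := by rw [← hal]; simp
    simpa [this] using hl
  have h2 : A.map K.subtype ≤ L := by
    rw [Submodule.map_le_iff_le_comap, h1]
    exact le_top
  rwa [sup_eq_right.2 h2] at hL

theorem exists_weakSupplement_step (K N : Submodule R M) (hK : WeaklySupplemented R K)
    (h : ∃ X, IsWeakSupplement R M (K ⊔ N) X) : ∃ X, IsWeakSupplement R M N X := by
  obtain ⟨X, hX, hXs⟩ := h
  obtain ⟨L, hL, hLs⟩ := hK ((N ⊔ X).comap K.subtype)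
  have hs := small_map_subtype K _ hLs
  have hLK : L.map K.subtype ≤ K := Submodule.map_subtype_le K L
  have hKle : K ≤ N ⊔ (X ⊔ L.map K.subtype) := by
    have : K = ((N ⊔ X).comap K.subtype).map K.subtype ⊔ L.map K.subtype := by
      rw [← Submodule.map_sup, hL, Submodule.map_subtype_top]
    rw [← sup_assoc]
    refine this.le.trans ?_
    exact sup_le_sup_right (Submodule.map_comap_le _ _) _
  refine ⟨X ⊔ L.map K.subtype, ?_, ?_⟩
  · rw [eq_top_iff, ← hX]
    exact sup_le (sup_le hKle le_sup_left) (le_sup_left.trans le_sup_right)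
  · intro Y hY
    apply hs
    apply hXs
    rw [eq_top_iff, ← hY, ← sup_assoc]
    refine sup_le_sup_right ?_ Y
    rintro y ⟨hyN, hy⟩
    obtain ⟨x, hx, l, hl, rfl⟩ := Submodule.mem_sup.1 hy
    refine Submodule.add_mem_sup ⟨?_, hx⟩ ?_
    · exact Submodule.mem_sup.2 ⟨-l, K.neg_mem (hLK hl), x + l, hyN, by abel⟩
    · obtain ⟨l', hl', rfl⟩ := hl
      refine ⟨l', ⟨?_, hl'⟩, rfl⟩
      exact Submodule.mem_sup.2 ⟨_, hyN, -x, X.neg_mem hx, by abel⟩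

end Helpers

/-- A finite sum of weakly supplemented submodules is weakly
supplemented. -/
theorem weaklySupplemented_of_finite_sum
    (R : Type u) [Ring R] (M : Type v) [AddCommGroup M] [Module R M]
    (n : ℕ) (Ms : Fin n → Submodule R M) (hsum : (⨆ i, Ms i) = ⊤)
    (h : ∀ i, WeaklySupplemented R ↥(Ms i)) :
    WeaklySupplemented R M := by
  intro N
  have key : ∀ (s : Finset (Fin n)) (N : Submodule R M),
      (∃ X, IsWeakSupplement R M (s.sup Ms ⊔ N) X) → ∃ X, IsWeakSupplement R M N X := by
    intro s
    induction s using Finset.induction_on with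
    | empty => intro N hN; simpa using hN
    | insert a s ha ih =>
      intro N hN
      apply ih
      apply exists_weakSupplement_step (Ms a) _ (h a)
      rwa [Finset.sup_insert, sup_assoc] at hN
  apply key Finset.univ
  rw [Finset.sup_univ_eq_iSup, hsum, top_sup_eq]
  refine ⟨⊥, by simp, ?_⟩
  intro L hL
  simpa using hL
end

section
/- For a left R-module M: (1) if M has finite hollow dimension then M is weakly supplemented; (2) if M is weakly supplemented then M is semilocal; (3) if M has finite hollow dimension then M/Rad(M) has finite length and hdim(M) ≥ length(M/Rad(M)); (4) if Rad(M) is small in M and M is semilocal, then M is weakly supplemented; (5) if M is finitely generated and semilocal, then M has finite hollow dimension and hdim(M) = length(M/Rad(M)). -/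
universe u v w

section Helpers

variable {R : Type u} [Ring R] {M : Type v} [AddCommGroup M] [Module R M]
  {P : Type w} [AddCommGroup P] [Module R P]

theorem small_mono {A B : Submodule R M} (h : A ≤ B) (hB : IsSmallSubmodule R M B) :
    IsSmallSubmodule R M A := fun L hL =>
  hB L (top_le_iff.mp (hL ▸ sup_le_sup_right h L))

theorem small_le_rad_s10 {A : Submodule R M} (h : IsSmallSubmodule R M A) :
    A ≤ moduleRad R M := by
  refine le_sInf fun C hC => ?_
  by_contra hn
  refine hC.1 (h C ?_)
  exact hC.2 _ (right_lt_sup.mpr hn)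

theorem isSmall_map (f : M →ₗ[R] P) {A : Submodule R M} (h : IsSmallSubmodule R M A) :
    IsSmallSubmodule R P (A.map f) := by
  intro L hL
  have h1 : L.comap f = ⊤ := by
    apply h
    rw [eq_top_iff]
    intro x _
    have hx : f x ∈ A.map f ⊔ L := by rw [hL]; trivial
    obtain ⟨y, ⟨a, ha, rfl⟩, l, hl, e⟩ := Submodule.mem_sup.mp hx
    refine Submodule.mem_sup.mpr ⟨a, ha, x - a, ?_, by abel⟩
    have : f (x - a) = l := by rw [map_sub, ← e]; abel
    simpa only [Submodule.mem_comap, this] using hl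
  have h2 : A.map f ≤ L := by
    rw [Submodule.map_le_iff_le_comap, h1]; exact le_top
  rwa [sup_eq_right.mpr h2] at hL

theorem small_comap (g : M →ₗ[R] P) (hg : Function.Surjective g)
    (hk : IsSmallSubmodule R M (LinearMap.ker g)) {A : Submodule R P}
    (hA : IsSmallSubmodule R P A) : IsSmallSubmodule R M (A.comap g) := by
  intro X hX
  have h1 : X.map g = ⊤ := by
    apply hA
    have := congrArg (Submodule.map g) hX
    rwa [Submodule.map_sup, Submodule.map_comap_eq_of_surjective hg, Submodule.map_top,
      LinearMap.range_eq_top.mpr hg] at this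
  apply hk
  rw [sup_comm, ← Submodule.comap_map_eq, h1, Submodule.comap_top]

theorem small_bot_s10 : IsSmallSubmodule R M ⊥ := fun L hL => by simpa using hL

theorem small_sup {A B : Submodule R M} (hA : IsSmallSubmodule R M A)
    (hB : IsSmallSubmodule R M B) : IsSmallSubmodule R M (A ⊔ B) := fun L hL =>
  hB L (hA _ (by rwa [sup_assoc] at hL))

theorem small_pi {n : ℕ} (H : Fin n → Type w) [∀ i, AddCommGroup (H i)]
    [∀ i, Module R (H i)] (A : ∀ i, Submodule R (H i))
    (hA : ∀ i, IsSmallSubmodule R (H i) (A i)) :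
    IsSmallSubmodule R (∀ i, H i) (Submodule.pi Set.univ A) := by
  rw [← Submodule.iSup_map_single, ← Finset.sup_univ_eq_iSup]
  exact Finset.sup_induction small_bot_s10 (fun a ha b hb => small_sup ha hb)
    (fun i _ => isSmall_map _ (hA i))

theorem weaklySupplemented_of_witness {n : ℕ} (w : HollowDimWitness R M n) :
    WeaklySupplemented R M := by
  classical
  obtain ⟨H, g, surj, hollow, small⟩ := w
  intro N
  let p : ∀ i, M →ₗ[R] H i := fun i => (LinearMap.proj i).comp g
  have hp : ∀ i, Function.Surjective (p i) := fun i =>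
    (LinearMap.proj_surjective (R := R) i).comp surj
  let L : Finset (Fin n) → Submodule R M := fun J => ⨅ j ∈ J, LinearMap.ker (p j)
  obtain ⟨J, hJ⟩ := (Set.toFinite {J : Finset (Fin n) | N ⊔ L J = ⊤}).exists_maximal
    ⟨∅, by simp [L]⟩
  refine ⟨L J, hJ.prop, ?_⟩
  have key : ∀ i, IsSmallSubmodule R (H i) ((N ⊓ L J).map (p i)) := by
    intro i
    by_cases hi : i ∈ J
    · have : (N ⊓ L J).map (p i) = ⊥ := by
        rw [eq_bot_iff, Submodule.map_le_iff_le_comap]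
        exact inf_le_right.trans (iInf₂_le i hi)
      rw [this]; exact small_bot_s10
    · apply (hollow i).2
      intro ht
      have h1 : (N ⊓ L J) ⊔ LinearMap.ker (p i) = ⊤ := by
        rw [← Submodule.comap_map_eq, ht, Submodule.comap_top]
      have h2 : L J = (N ⊓ L J) ⊔ (LinearMap.ker (p i) ⊓ L J) := by
        rw [← sup_inf_assoc_of_le _ (inf_le_right : N ⊓ L J ≤ L J), h1, top_inf_eq]
      have h3 : L (insert i J) = LinearMap.ker (p i) ⊓ L J := by
        simp only [L, Finset.iInf_insert]
      have h4 : N ⊔ L (insert i J) = ⊤ := by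
        have h5 : N ⊔ L J = ⊤ := hJ.prop
        rw [h2, ← sup_assoc, sup_inf_self] at h5
        rw [h3, h5]
      exact hi (hJ.le_of_ge (y := insert i J) h4 (Finset.subset_insert i J)
        (Finset.mem_insert_self i J))
  refine small_mono ?_ (small_comap g surj small (small_pi H _ key))
  intro x hx
  simp only [Submodule.mem_comap, Submodule.mem_pi]
  exact fun i _ => ⟨x, hx, rfl⟩

theorem semilocal_of_weaklySupplemented (h : WeaklySupplemented R M) :
    IsSemilocalModule R M := by
  unfold IsSemilocalModule
  rw [isSemisimpleModule_iff]
  refine ⟨fun N => ?_⟩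
  set q := (moduleRad R M).mkQ
  have hq : Function.Surjective q := Submodule.mkQ_surjective _
  obtain ⟨L, h1, h2⟩ := h (N.comap q)
  refine ⟨L.map q, ?_, ?_⟩
  · rw [Submodule.disjoint_def]
    rintro _ hx ⟨l, hl, rfl⟩
    have : l ∈ moduleRad R M := small_le_rad_s10 h2 ⟨hx, hl⟩
    simpa [q] using this
  · rw [codisjoint_iff]
    have := congrArg (Submodule.map q) h1
    rwa [Submodule.map_sup, Submodule.map_comap_eq_of_surjective hq, Submodule.map_top,
      LinearMap.range_eq_top.mpr hq] at this

theorem weaklySupplemented_of_small (hs : IsSmallSubmodule R M (moduleRad R M))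
    (h : IsSemilocalModule R M) : WeaklySupplemented R M := by
  intro N
  unfold IsSemilocalModule at h
  set q := (moduleRad R M).mkQ
  have hq : Function.Surjective q := Submodule.mkQ_surjective _
  obtain ⟨C, hC⟩ := exists_isCompl (N.map q)
  refine ⟨C.comap q, ?_, small_mono ?_ hs⟩
  · have h1 : moduleRad R M ≤ C.comap q := by
      intro x hx
      have : q x = 0 := by simpa [q] using hx
      simp [this]
    have h2 : (N ⊔ C.comap q).map q = ⊤ := by
      rw [Submodule.map_sup, Submodule.map_comap_eq_of_surjective hq]
      exact hC.sup_eq_top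
    have h3 := congrArg (Submodule.comap q) h2
    rw [Submodule.comap_map_eq, Submodule.comap_top, Submodule.ker_mkQ, sup_assoc,
      sup_eq_left.mpr h1] at h3
    exact h3
  · rintro x ⟨h1, h2⟩
    have : q x = 0 := Submodule.disjoint_def.mp hC.disjoint _ ⟨x, h1, rfl⟩ h2
    simpa [q] using this

theorem hollow_rad {C : Submodule R M} (hM : IsHollowModule R M) (hC : IsCoatom C) :
    moduleRad R M = C :=
  le_antisymm (sInf_le hC) (small_le_rad_s10 (hM.2 C hC.1))

theorem hollow_length_le (hM : IsHollowModule R M) :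
    Module.length R (M ⧸ moduleRad R M) ≤ 1 := by
  by_cases h : ∃ C : Submodule R M, IsCoatom C
  · obtain ⟨C, hC⟩ := h
    rw [hollow_rad hM hC, Module.length_eq_one_iff.mpr (isSimpleModule_iff_isCoatom.mpr hC)]
  · have : moduleRad R M = ⊤ := by
      rw [moduleRad, sInf_eq_top]
      exact fun C hC => (h ⟨C, hC⟩).elim
    have : Subsingleton (M ⧸ moduleRad R M) := Submodule.Quotient.subsingleton_iff.mpr this
    rw [Module.length_eq_zero]; exact zero_le_one

theorem hollow_length_eq (hM : IsHollowModule R M) [Module.Finite R M] :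
    Module.length R (M ⧸ moduleRad R M) = 1 := by
  have := hM.1
  obtain ⟨C, hC, -⟩ := (eq_top_or_exists_le_coatom (⊥ : Submodule R M)).resolve_left bot_ne_top
  rw [hollow_rad hM hC, Module.length_eq_one_iff.mpr (isSimpleModule_iff_isCoatom.mpr hC)]

theorem rad_pi {n : ℕ} (H : Fin n → Type w) [∀ i, AddCommGroup (H i)]
    [∀ i, Module R (H i)] :
    Module.jacobson R (∀ i, H i) = Submodule.pi Set.univ fun i => Module.jacobson R (H i) := by
  refine le_antisymm (Module.jacobson_pi_le R H) ?_
  rw [← Submodule.iSup_map_single]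
  exact iSup_le fun i => Module.map_jacobson_le _

theorem length_eq_sum {n : ℕ} (H : Fin n → Type v) [∀ i, AddCommGroup (H i)]
    [∀ i, Module R (H i)] (g : M →ₗ[R] ∀ i, H i) (surj : Function.Surjective g)
    (small : IsSmallSubmodule R M (LinearMap.ker g)) :
    Module.length R (M ⧸ moduleRad R M) =
      ∑ i, Module.length R (H i ⧸ moduleRad R (H i)) := by
  let q : (∀ i, H i) →ₗ[R] ∀ i, H i ⧸ moduleRad R (H i) :=
    LinearMap.pi fun i => (moduleRad R (H i)).mkQ.comp (LinearMap.proj i)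
  have hq : Function.Surjective q := by
    intro y
    choose x hx using fun i => Submodule.mkQ_surjective _ (y i)
    exact ⟨x, funext hx⟩
  have hk : LinearMap.ker (q.comp g) = moduleRad R M := by
    have h1 : LinearMap.ker q = Module.jacobson R (∀ i, H i) := by
      rw [rad_pi]
      ext x
      simp only [LinearMap.mem_ker, Submodule.mem_pi, funext_iff]
      refine forall_congr' fun i => ?_
      have h0 : q x i = (moduleRad R (H i)).mkQ (x i) := rfl
      have h2 : moduleRad R (H i) = Module.jacobson R (H i) := rfl
      rw [h0, Pi.zero_apply, Submodule.mkQ_apply, Submodule.Quotient.mk_eq_zero, h2]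
      simp
    rw [LinearMap.ker_comp, h1]
    exact Module.comap_jacobson_of_ker_le surj (small_le_rad_s10 small)
  rw [← Module.length_pi_of_fintype, ← hk]
  exact ((q.comp g).quotKerEquivOfSurjective (hq.comp surj)).length_eq

theorem lengthIs_of_length {n : ℕ} (h : Module.length R M = n) : ModuleLengthIs R M n := by
  have hf : IsFiniteLength R M := Module.length_ne_top_iff.mp (by simp [h])
  obtain ⟨s, h1, h2⟩ := isFiniteLength_iff_exists_compositionSeries.mp hf
  refine ⟨s, h1, h2, ?_⟩
  have := Module.length_compositionSeries s h1 h2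
  rw [h] at this
  exact_mod_cast this

theorem rad_small_of_finite [Module.Finite R M] : IsSmallSubmodule R M (moduleRad R M) := by
  intro L hL
  refine (eq_top_or_exists_le_coatom L).resolve_right ?_
  rintro ⟨C, hC, hLC⟩
  exact hC.1 (top_le_iff.mp (hL ▸ sup_le (sInf_le hC) hLC))

theorem hollow_of_simple [IsSimpleModule R M] : IsHollowModule R M := by
  refine ⟨IsSimpleModule.nontrivial R M, fun N hN => ?_⟩
  rw [(eq_bot_or_eq_top N).resolve_right hN]
  exact small_bot_s10

theorem hasFiniteHollowDim_of_finite [Module.Finite R M] (h : IsSemilocalModule R M) :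
    HasFiniteHollowDim R M := by
  unfold IsSemilocalModule at h
  obtain ⟨n, S, e, hS⟩ :=
    IsSemisimpleModule.exists_linearEquiv_fin_dfinsupp R (M ⧸ moduleRad R M)
  let e' := e.trans (DFinsupp.linearEquivFunOnFintype (R := R) (M := fun i => S i))
  have hs : Function.Surjective (e'.toLinearMap.comp (moduleRad R M).mkQ) :=
    e'.surjective.comp (Submodule.mkQ_surjective _)
  have hk : IsSmallSubmodule R M (LinearMap.ker (e'.toLinearMap.comp (moduleRad R M).mkQ)) := by
    rw [LinearEquiv.ker_comp, Submodule.ker_mkQ]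
    exact rad_small_of_finite
  exact ⟨n, ⟨⟨fun i => S i, _, hs, fun i => hollow_of_simple, hk⟩⟩⟩

end Helpers

/-- Finite hollow dimension ⇒ weakly supplemented ⇒ semilocal;
`hdim M ≥ length (M/Rad M)`; semilocal + small radical ⇒ weakly supplemented;
finitely generated + semilocal ⇒ finite hollow dimension with
`hdim M = length (M/Rad M)`. -/
theorem hollowDim_weaklySupplemented_semilocal
    (R : Type u) [Ring R] (M : Type v) [AddCommGroup M] [Module R M] :
    (HasFiniteHollowDim R M → WeaklySupplemented R M) ∧
    (WeaklySupplemented R M → IsSemilocalModule R M) ∧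
    (∀ n : ℕ, Nonempty (HollowDimWitness R M n) →
      IsFiniteLength R (M ⧸ moduleRad R M) ∧
      ∀ k : ℕ, ModuleLengthIs R (M ⧸ moduleRad R M) k → k ≤ n) ∧
    (IsSmallSubmodule R M (moduleRad R M) → IsSemilocalModule R M →
      WeaklySupplemented R M) ∧
    (Module.Finite R M → IsSemilocalModule R M →
      HasFiniteHollowDim R M ∧
      ∀ n : ℕ, Nonempty (HollowDimWitness R M n) →
        ModuleLengthIs R (M ⧸ moduleRad R M) n) := by
  refine ⟨?_, semilocal_of_weaklySupplemented, ?_, weaklySupplemented_of_small, ?_⟩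
  · rintro ⟨n, ⟨w⟩⟩
    exact weaklySupplemented_of_witness w
  · rintro n ⟨⟨H, g, surj, hollow, small⟩⟩
    have hle : Module.length R (M ⧸ moduleRad R M) ≤ n := by
      rw [length_eq_sum H g surj small]
      calc _ ≤ ∑ i : Fin n, (1 : ℕ∞) := Finset.sum_le_sum fun i _ => hollow_length_le (hollow i)
        _ = n := by simp
    refine ⟨Module.length_ne_top_iff.mp (ne_top_of_le_ne_top (ENat.natCast_ne_top n) hle), ?_⟩
    rintro k ⟨s, h1, h2, rfl⟩
    rw [← Module.length_compositionSeries s h1 h2] at hle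
    exact_mod_cast hle
  · intro hfin hsl
    refine ⟨hasFiniteHollowDim_of_finite hsl, ?_⟩
    rintro n ⟨⟨H, g, surj, hollow, small⟩⟩
    apply lengthIs_of_length
    rw [length_eq_sum H g surj small]
    have hF : ∀ i, Module.Finite R (H i) := fun i =>
      Module.Finite.of_surjective ((LinearMap.proj i).comp g)
        ((LinearMap.proj_surjective (R := R) i).comp surj)
    rw [Finset.sum_congr rfl fun i _ => hollow_length_eq (hollow i)]
    simp
end

section
/- Let R be a ring and r, a ∈ R, and set b := 1 − ra. Then Ra ∩ Rb = Rab, i.e. Ra ∩ R(1 − ra) = Ra(1 − ra). -/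
universe u v w

/-- For `r, a ∈ R` and `b = 1 - ra` one has `Ra ∩ Rb = Rab`. -/
theorem span_inf_span_one_sub (R : Type u) [Ring R] (r a b : R) (hb : b = 1 - r * a) :
    Ideal.span {a} ⊓ Ideal.span {b} = Ideal.span {a * b} := by
  ext x
  simp only [Submodule.mem_inf, Ideal.mem_span_singleton']
  constructor
  · rintro ⟨⟨s, hs⟩, ⟨t, ht⟩⟩
    have h : t = (s + t * r) * a := by
      have h1 : t - t * (r * a) = s * a := by
        rw [hs, ← ht, hb, mul_sub, mul_one]
      rw [add_mul, ← h1, mul_assoc, sub_add_cancel]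
    refine ⟨s + t * r, ?_⟩
    rw [← mul_assoc, ← h, ht]
  · rintro ⟨s, hs⟩
    refine ⟨⟨s * (1 - a * r), ?_⟩, ⟨s * a, ?_⟩⟩
    · rw [← hs, hb]
      noncomm_ring
    · rw [mul_assoc, hs]
end

section
/- A ring R is semilocal if and only if every product (direct product over an arbitrary index set) of semisimple left R-modules is a semisimple left R-module. -/
universe u v w

/-- A ring is semilocal iff every product of semisimple left
modules is semisimple. -/
theorem semilocal_iff_product_of_semisimple_is_semisimple
    (R : Type u) [Ring R] :
    IsSemilocalModule R R ↔
      ∀ (ι : Type u) (N : ι → Type u) [∀ i, AddCommGroup (N i)]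
        [∀ i, Module R (N i)],
        (∀ i, IsSemisimpleModule R (N i)) → IsSemisimpleModule R (∀ i, N i) := by
  constructor
  · intro h ι N _ _ hN
    have h' : IsSemisimpleModule R (R ⧸ moduleRad R R) := h
    have hJ : moduleRad R R = Ring.jacobson R := rfl
    have key : ∀ x : (∀ i, N i), IsSemisimpleModule R
        (LinearMap.range (LinearMap.toSpanSingleton R (∀ i, N i) x)) := by
      intro x
      have hk : moduleRad R R ≤ LinearMap.ker (LinearMap.toSpanSingleton R (∀ i, N i) x) := by
        intro r hr
        rw [hJ] at hr
        rw [LinearMap.mem_ker, LinearMap.toSpanSingleton_apply]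
        funext i
        have := hN i
        exact Module.mem_annihilator.mp
          (IsSemisimpleModule.jacobson_le_annihilator R (N i) hr) (x i)
      rw [← Submodule.range_liftQ (moduleRad R R) _ hk]
      exact IsSemisimpleModule.range _
    refine isSemisimpleModule_of_isSemisimpleModule_submodule' (p := fun x : (∀ i, N i) =>
      LinearMap.range (LinearMap.toSpanSingleton R (∀ i, N i) x)) key ?_
    rw [eq_top_iff]
    intro x _
    exact Submodule.mem_iSup_of_mem x ⟨1, by simp⟩
  · intro h
    let ι := {N : Submodule R R // IsCoatom N}
    have hs : IsSemisimpleModule R (∀ i : ι, R ⧸ i.1) := h ι (fun i => R ⧸ i.1) (fun i => by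
      have : IsSimpleModule R (R ⧸ i.1) := isSimpleModule_iff_isCoatom.mpr i.2
      infer_instance)
    let f : R →ₗ[R] (∀ i : ι, R ⧸ i.1) := LinearMap.pi fun i => i.1.mkQ
    have hf : LinearMap.ker f = moduleRad R R := by
      ext r
      simp [f, moduleRad, ι, LinearMap.ker_pi, Submodule.mem_sInf]
    show IsSemisimpleModule R (R ⧸ moduleRad R R)
    rw [← hf]
    exact IsSemisimpleModule.congr (M := LinearMap.range f) f.quotKerEquivRange
end

section
/- For a ring R the following are equivalent: (a) R is semilocal; (b) there exist n ∈ ℕ and a map d : R → {0, 1, …, n} such that for all a, b ∈ R: (i) d(a) = 0 implies a is a unit of R, and (ii) d(a(1 − ba)) = d(a) + d(1 − ba); (c) there exists a partial ordering ≤ on R such that (i) (R, ≤) is an artinian poset (no infinite strictly descending chain), and (ii) for all a, b ∈ R such that 1 − ba is not a unit, a > a(1 − ba). -/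
universe u v w

lemma cd_isUnit_of_sub_one_mem {R : Type u} [Ring R] {r : R} (h : r - 1 ∈ Ring.jacobson R) :
    IsUnit r := by
  have key : ∀ r : R, r - 1 ∈ Ring.jacobson R → ∃ s, s * r = 1 := by
    intro r h
    rw [← Ideal.jacobson_bot] at h
    obtain ⟨s, hs⟩ := Ideal.exists_mul_sub_mem_of_sub_one_mem_jacobson r h
    exact ⟨s, sub_eq_zero.mp (by simpa using hs)⟩
  obtain ⟨s, hs⟩ := key r h
  have h2 : s - 1 ∈ Ring.jacobson R := by
    have : s - 1 = -(s * (r - 1)) := by rw [mul_sub, hs]; simp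
    rw [this]
    exact neg_mem (Ideal.mul_mem_left _ _ h)
  obtain ⟨t, ht⟩ := key s h2
  have htr : t = r := by
    calc t = t * (s * r) := by rw [hs, mul_one]
      _ = r := by rw [← mul_assoc, ht, one_mul]
  subst htr
  exact ⟨⟨t, s, ht, hs⟩, rfl⟩

lemma cd_isUnit_of_quot {R : Type u} [Ring R] {a : R}
    (h : IsUnit (Ideal.Quotient.mk (Ring.jacobson R) a)) : IsUnit a := by
  obtain ⟨⟨_, b', h1, h2⟩, rfl⟩ := h
  obtain ⟨b, rfl⟩ := Ideal.Quotient.mk_surjective b'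
  rw [← map_mul, ← map_one (Ideal.Quotient.mk (Ring.jacobson R)), Ideal.Quotient.mk_eq_mk_iff_sub_mem] at h1 h2
  obtain ⟨u, hu⟩ := cd_isUnit_of_sub_one_mem h1
  obtain ⟨v, hv⟩ := cd_isUnit_of_sub_one_mem h2
  rw [isUnit_iff_exists_and_exists]
  refine ⟨⟨b * ↑u⁻¹, ?_⟩, ⟨↑v⁻¹ * b, ?_⟩⟩
  · rw [← mul_assoc, ← hu, Units.mul_inv]
  · rw [mul_assoc, ← hv, Units.inv_mul]

lemma cd_length {S : Type u} [Ring S] {M : Type v} [AddCommGroup M] [Module S M]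
    (f g : M →ₗ[S] M) :
    Module.length S (LinearMap.ker ((LinearMap.id - f ∘ₗ g) ∘ₗ f)) =
      Module.length S (LinearMap.ker f) +
        Module.length S (LinearMap.ker (LinearMap.id - f ∘ₗ g)) := by
  have hle : LinearMap.ker f ≤ LinearMap.ker ((LinearMap.id - f ∘ₗ g) ∘ₗ f) :=
    LinearMap.ker_le_ker_comp _ _
  refine Module.length_eq_add_of_exact (Submodule.inclusion hle)
    (f.restrict (p := LinearMap.ker ((LinearMap.id - f ∘ₗ g) ∘ₗ f))
      (q := LinearMap.ker (LinearMap.id - f ∘ₗ g)) (fun x hx => hx))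
    (Submodule.inclusion_injective hle) ?_ ?_
  · rintro ⟨y, hy⟩
    have hy' : f (g y) = y := by
      have h3 : y - f (g y) = 0 := hy
      exact (sub_eq_zero.mp h3).symm
    refine ⟨⟨g y, ?_⟩, ?_⟩
    · simp [hy']
    · exact Subtype.ext hy'
  · rintro ⟨x, hx⟩
    constructor
    · intro h
      exact ⟨⟨x, congrArg Subtype.val h⟩, rfl⟩
    · rintro ⟨⟨y, hy⟩, h⟩
      have : y = x := congrArg Subtype.val h
      subst this
      exact Subtype.ext hy

lemma cd_a_b (R : Type u) [Ring R] (h : IsSemilocalModule R R) :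
    ∃ (n : ℕ) (d : R → ℕ),
        (∀ a : R, d a ≤ n) ∧
        (∀ a : R, d a = 0 → IsUnit a) ∧
        (∀ a b : R, d (a * (1 - b * a)) = d a + d (1 - b * a)) := by
  have h' : IsSemisimpleModule R (R ⧸ Ring.jacobson R) := h
  let π := Ideal.Quotient.mk (Ring.jacobson R)
  have : RingHomSurjective π := ⟨Ideal.Quotient.mk_surjective⟩
  let e : (R ⧸ Ring.jacobson R) →ₛₗ[π] (R ⧸ Ring.jacobson R) :=
    { AddMonoidHom.id (R ⧸ Ring.jacobson R) with
      map_smul' := fun r x => by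
        obtain ⟨x, rfl⟩ := Ideal.Quotient.mk_surjective x
        rfl }
  have hS : IsSemisimpleRing (R ⧸ Ring.jacobson R) :=
    (e.isSemisimpleModule_iff_of_bijective Function.bijective_id).mp h'
  let S := R ⧸ Ring.jacobson R
  let ρ : R → (S →ₗ[S] S) := fun a => LinearMap.toSpanSingleton S S (π a)
  have hρ : ∀ a x, ρ a x = x * π a := fun a x => rfl
  have hfin : ∀ N : Submodule S S, Module.length S N ≠ ⊤ := fun N => Module.length_ne_top
  refine ⟨(Module.length S S).toNat, fun a => (Module.length S (LinearMap.ker (ρ a))).toNat,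
    ?_, ?_, ?_⟩
  · intro a
    exact ENat.toNat_le_toNat (Module.length_le_of_injective _ (Submodule.subtype_injective _))
      Module.length_ne_top
  · intro a ha
    have h0 : Module.length S (LinearMap.ker (ρ a)) = 0 := by
      rcases (ENat.toNat_eq_zero).mp ha with h | h
      · exact h
      · exact absurd h (hfin _)
    rw [Module.length_eq_zero_iff, Submodule.subsingleton_iff_eq_bot, LinearMap.ker_eq_bot] at h0
    obtain ⟨b, hb⟩ := (IsArtinian.bijective_of_injective_endomorphism _ h0).2 (1 : S)
    rw [hρ] at hb
    apply cd_isUnit_of_quot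
    refine ⟨⟨π a, b, h0 ?_, hb⟩, rfl⟩
    rw [hρ, hρ, mul_assoc, hb, mul_one, one_mul]
  · intro a b
    have h1 : ρ (1 - b * a) = LinearMap.id - ρ a ∘ₗ ρ b := by
      apply LinearMap.ext
      intro x
      simp [hρ, mul_sub, mul_assoc]
    have h2 : ρ (a * (1 - b * a)) = (LinearMap.id - ρ a ∘ₗ ρ b) ∘ₗ ρ a := by
      rw [← h1]
      apply LinearMap.ext
      intro x
      simp [hρ, mul_assoc]
    dsimp only
    rw [h1, h2, cd_length, ENat.toNat_add (hfin _) (hfin _)]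

lemma cd_b_c (R : Type u) [Ring R] (h : ∃ (n : ℕ) (d : R → ℕ),
        (∀ a : R, d a ≤ n) ∧
        (∀ a : R, d a = 0 → IsUnit a) ∧
        (∀ a b : R, d (a * (1 - b * a)) = d a + d (1 - b * a))) :
    ∃ le : R → R → Prop,
        IsPartialOrder R le ∧
        WellFounded (fun x y : R => le x y ∧ x ≠ y) ∧
        (∀ a b : R, ¬ IsUnit (1 - b * a) →
          le (a * (1 - b * a)) a ∧ a * (1 - b * a) ≠ a) := by
  obtain ⟨n, d, hn, h0, hd⟩ := h
  refine ⟨fun x y => x = y ∨ d y < d x, ?_, ?_, ?_⟩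
  · exact
      { refl := fun a => Or.inl rfl
        trans := by
          rintro a b c (rfl | h1) (rfl | h2)
          · exact Or.inl rfl
          · exact Or.inr h2
          · exact Or.inr h1
          · exact Or.inr (h2.trans h1)
        antisymm := by
          rintro a b (rfl | h1) (h | h2)
          · rfl
          · rfl
          · exact h.symm
          · omega }
  · refine Subrelation.wf ?_ (measure (fun x => n - d x)).wf
    rintro x y ⟨h | h, hne⟩
    · exact absurd h hne
    · have := hn x
      change n - d x < n - d y
      omega
  · intro a b hu
    have h1 : d (1 - b * a) ≠ 0 := fun h => hu (h0 _ h)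
    have h2 := hd a b
    refine ⟨Or.inr (by omega), fun h => ?_⟩
    rw [h] at h2
    omega

lemma cd_c_a (R : Type u) [Ring R] (h : ∃ le : R → R → Prop,
        IsPartialOrder R le ∧
        WellFounded (fun x y : R => le x y ∧ x ≠ y) ∧
        (∀ a b : R, ¬ IsUnit (1 - b * a) →
          le (a * (1 - b * a)) a ∧ a * (1 - b * a) ≠ a)) : IsSemilocalModule R R := by
  obtain ⟨le, -, hwf, hle⟩ := h
  change IsSemisimpleModule R (R ⧸ Ring.jacobson R)
  rw [isSemisimpleModule_iff]
  refine ⟨fun N => ?_⟩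
  let L : Submodule R R := N.comap (Ring.jacobson R).mkQ
  obtain ⟨a, ha, hmin⟩ := hwf.has_min {a : R | 1 - a ∈ L} ⟨1, by simp⟩
  have ha : 1 - a ∈ L := ha
  have hunit : ∀ b, b * a ∈ L → IsUnit (1 - b * a) := by
    intro b hb
    by_contra hu
    refine hmin (a * (1 - b * a)) ?_ (hle a b hu)
    change 1 - a * (1 - b * a) ∈ L
    have : 1 - a * (1 - b * a) = (1 - a) + a • (b * a) := by
      rw [smul_eq_mul]; noncomm_ring
    rw [this]
    exact add_mem ha (L.smul_mem _ hb)
  have hJ : ∀ b, b * a ∈ L → b * a ∈ Ring.jacobson R := by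
    intro b hb
    rw [← Ideal.jacobson_bot, Ideal.mem_jacobson_iff]
    intro y
    obtain ⟨u, hu⟩ := hunit (-(y * b)) (by
      have := L.smul_mem (-y) hb
      simpa [mul_assoc] using this)
    refine ⟨↑u⁻¹, ?_⟩
    have h1 : (↑u⁻¹ : R) * u = 1 := Units.inv_mul u
    rw [hu] at h1
    have : (↑u⁻¹ : R) * y * (b * a) + ↑u⁻¹ - 1 = ↑u⁻¹ * (1 - -(y * b) * a) - 1 := by
      noncomm_ring
    rw [this, h1]
    simp
  refine ⟨(Submodule.span R {a}).map (Ring.jacobson R).mkQ, ?_, ?_⟩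
  · rw [Submodule.disjoint_def]
    rintro x hx ⟨y, hy, rfl⟩
    obtain ⟨b, rfl⟩ := Submodule.mem_span_singleton.mp hy
    rw [Submodule.mkQ_apply, Submodule.Quotient.mk_eq_zero]
    exact hJ b hx
  · rw [codisjoint_iff, eq_top_iff]
    rintro x -
    obtain ⟨r, rfl⟩ := Submodule.mkQ_surjective _ x
    have : r = r • (1 - a) + r • a := by simp [mul_sub]
    rw [this, map_add]
    refine Submodule.add_mem_sup (L.smul_mem r ha) (Submodule.mem_map_of_mem ?_)
    exact Submodule.smul_mem _ _ (Submodule.mem_span_singleton_self a)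

/-- Camps–Dicks characterization of semilocal rings. -/
theorem semilocal_ring_camps_dicks (R : Type u) [Ring R] :
    (IsSemilocalModule R R ↔
      ∃ (n : ℕ) (d : R → ℕ),
        (∀ a : R, d a ≤ n) ∧
        (∀ a : R, d a = 0 → IsUnit a) ∧
        (∀ a b : R, d (a * (1 - b * a)) = d a + d (1 - b * a))) ∧
    (IsSemilocalModule R R ↔
      ∃ le : R → R → Prop,
        IsPartialOrder R le ∧
        WellFounded (fun x y : R => le x y ∧ x ≠ y) ∧
        (∀ a b : R, ¬ IsUnit (1 - b * a) →
          le (a * (1 - b * a)) a ∧ a * (1 - b * a) ≠ a)) := by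
  exact ⟨⟨cd_a_b R, fun h => cd_c_a R (cd_b_c R h)⟩, ⟨fun h => cd_b_c R (cd_a_b R h), cd_c_a R⟩⟩
end

section
/- Let R be a semilocal ring and M a finitely generated left R-module. Then M is a direct summand of a module having a finitely generated free small cover: there exist k ∈ ℕ, a left R-module X, and an epimorphism f : R^k → M ⊕ X whose kernel is small in R^k. -/
universe u v w

/-- A witness that `M` is a direct summand of a module having a finitely generated
free small cover: an epimorphism `R^k → M ⊕ X` with small kernel. -/
structure FgFreeSmallCoverOfSummand (R : Type u) [Ring R]
    (M : Type v) [AddCommGroup M] [Module R M] where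
  k : ℕ
  X : Type (max u v)
  [xAdd : AddCommGroup X]
  [xMod : Module R X]
  f : (Fin k → R) →ₗ[R] M × X
  surj : Function.Surjective f
  small : IsSmallSubmodule R (Fin k → R) (LinearMap.ker f)

/-- Every finitely generated module over a semilocal ring is a
direct summand of a module having a finitely generated free small cover. -/
theorem fg_module_over_semilocal_summand_of_free_cover
    (R : Type u) [Ring R] (M : Type v) [AddCommGroup M] [Module R M]
    [Module.Finite R M] (hR : IsSemilocalModule R R) :
    Nonempty (FgFreeSmallCoverOfSummand R M) := by
  classical
  obtain ⟨k, g, hg⟩ := Module.Finite.exists_fin' R M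
  have hR' : IsSemisimpleModule R (R ⧸ moduleRad R R) := hR
  let J : Submodule R (Fin k → R) := Submodule.pi Set.univ (fun _ => moduleRad R R)
  have hJs : IsSemisimpleModule R ((Fin k → R) ⧸ J) := by
    let φ : (Fin k → R) →ₗ[R] (Fin k → R ⧸ moduleRad R R) :=
      LinearMap.pi fun i => (moduleRad R R).mkQ ∘ₗ LinearMap.proj i
    have hφ : LinearMap.ker φ = J := by
      ext x
      constructor
      · intro hx i _
        exact (Submodule.Quotient.mk_eq_zero _).mp (congrFun (LinearMap.mem_ker.mp hx) i)
      · intro hx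
        refine LinearMap.mem_ker.mpr (funext fun i => ?_)
        exact (Submodule.Quotient.mk_eq_zero _).mpr (hx i (Set.mem_univ i))
    refine IsSemisimpleModule.of_injective (J.liftQ φ hφ.ge) ?_
    rw [← LinearMap.ker_eq_bot]
    exact Submodule.ker_liftQ_eq_bot _ _ _ hφ.le
  have hJ : J ≤ Module.jacobson R (Fin k → R) := by
    intro x hx
    rw [← Finset.univ_sum_single x]
    refine Submodule.sum_mem _ fun i _ => ?_
    have h1 : x i ∈ Module.jacobson R R := hx i (Set.mem_univ i)
    exact Module.map_jacobson_le (LinearMap.single R (fun _ : Fin k => R) i)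
      (Submodule.mem_map_of_mem h1)
  have hsmall : IsSmallSubmodule R (Fin k → R) J := by
    intro L hL
    rcases eq_top_or_exists_le_coatom L with h | ⟨C, hC, hLC⟩
    · exact h
    · exact absurd (top_le_iff.mp (hL ▸ sup_le (hJ.trans (sInf_le hC)) hLC)) hC.1
  obtain ⟨Q, hQ⟩ := exists_isCompl ((LinearMap.ker g).map J.mkQ)
  let L := Q.comap J.mkQ
  have hsup : LinearMap.ker g ⊔ L = ⊤ := by
    rw [eq_top_iff]
    intro x _
    have hx : J.mkQ x ∈ (LinearMap.ker g).map J.mkQ ⊔ Q := by rw [hQ.sup_eq_top]; trivial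
    obtain ⟨_, ⟨a, ha, rfl⟩, q, hq, h⟩ := Submodule.mem_sup.mp hx
    refine Submodule.mem_sup.mpr ⟨a, ha, x - a, ?_, by abel⟩
    change J.mkQ (x - a) ∈ Q
    rw [map_sub, ← h, add_sub_cancel_left]
    exact hq
  have hinf : LinearMap.ker g ⊓ L ≤ J := by
    rintro x ⟨hx, hxL⟩
    have : J.mkQ x ∈ (LinearMap.ker g).map J.mkQ ⊓ Q :=
      ⟨Submodule.mem_map_of_mem hx, hxL⟩
    rw [hQ.inf_eq_bot, Submodule.mem_bot] at this
    exact (Submodule.Quotient.mk_eq_zero J).mp this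
  let e : ((Fin k → R) ⧸ L) ≃ₗ[R] ULift.{v} ((Fin k → R) ⧸ L) := ULift.moduleEquiv.symm
  refine ⟨{ k := k, X := ULift.{v} ((Fin k → R) ⧸ L),
            f := g.prod (e.toLinearMap ∘ₗ L.mkQ), surj := ?_, small := ?_ }⟩
  · rintro ⟨m, y⟩
    obtain ⟨a, rfl⟩ := hg m
    obtain ⟨q, rfl⟩ := e.surjective y
    obtain ⟨b, rfl⟩ := L.mkQ_surjective q
    have hab : b - a ∈ LinearMap.ker g ⊔ L := by rw [hsup]; trivial
    obtain ⟨n, hn, l, hl, h⟩ := Submodule.mem_sup.mp hab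
    refine ⟨a + n, Prod.ext ?_ ?_⟩
    · change g (a + n) = g a
      rw [map_add, LinearMap.mem_ker.mp hn, add_zero]
    · change e (L.mkQ (a + n)) = e (L.mkQ b)
      congr 1
      refine (Submodule.Quotient.eq L).mpr ?_
      have : a + n - b = -l := by
        rw [eq_neg_iff_add_eq_zero, show a + n - b + l = (n + l) - (b - a) by abel, h, sub_self]
      rw [this]
      exact L.neg_mem hl
  · intro T hT
    refine hsmall T (top_le_iff.mp (hT ▸ sup_le_sup_right (le_trans ?_ hinf) T))
    intro x hx
    have hx' : (g x, e (L.mkQ x)) = 0 := hx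
    rw [Prod.mk_eq_zero, LinearEquiv.map_eq_zero_iff] at hx'
    exact ⟨hx'.1, (Submodule.Quotient.mk_eq_zero L).mp hx'.2⟩
end

section
/- For a ring R the following are equivalent: (a) R is semiperfect; (b) R is semilocal and every simple left R-module has a flat cover; (c) R is semilocal and every finitely generated left R-module has a flat cover. -/
universe u v w

/-- Flatness over an arbitrary ring, via the standard equational criterion:
whenever `∑ aᵢ • mᵢ = 0` there are `yⱼ` and `bᵢⱼ` with `mᵢ = ∑ⱼ bᵢⱼ • yⱼ` and
`∑ᵢ aᵢ bᵢⱼ = 0`. -/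
def IsFlatModule (R : Type u) [Ring R] (M : Type v) [AddCommGroup M]
    [Module R M] : Prop :=
  ∀ (n : ℕ) (a : Fin n → R) (m : Fin n → M), (∑ i, a i • m i) = 0 →
    ∃ (k : ℕ) (b : Fin n → Fin k → R) (y : Fin k → M),
      (∀ i, m i = ∑ j, b i j • y j) ∧ ∀ j, (∑ i, a i * b i j) = 0

/-- A flat cover (by a small epimorphism) of the module `S`. -/
structure FlatCover (R : Type u) [Ring R] (S : Type u) [AddCommGroup S]
    [Module R S] where
  N : Type u
  [nAdd : AddCommGroup N]
  [nMod : Module R N]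
  flat : IsFlatModule R N
  f : N →ₗ[R] S
  surj : Function.Surjective f
  small : IsSmallSubmodule R N (LinearMap.ker f)

/-- `R` is semiperfect: `R/Jac R` is semisimple and idempotents lift modulo
`Jac R`. -/
def IsSemiperfectRing' (R : Type u) [Ring R] : Prop :=
  IsSemilocalModule R R ∧
    ∀ a : R, a * a - a ∈ moduleRad R R →
      ∃ e : R, e * e = e ∧ e - a ∈ moduleRad R R

section Helpers

variable {R : Type u} [Ring R]

/-- A finitely generated module has small radical. -/
theorem small_rad (M : Type v) [AddCommGroup M] [Module R M] [Module.Finite R M] :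
    IsSmallSubmodule R M (moduleRad R M) := by
  intro L hL
  by_contra hne
  obtain ⟨m, hm, hLm⟩ := (eq_top_or_exists_le_coatom L).resolve_left hne
  have h1 : moduleRad R M ≤ m := sInf_le hm
  exact hm.1 (top_le_iff.mp (hL ▸ sup_le h1 hLm))

theorem IsSmallSubmodule.mono {M : Type v} [AddCommGroup M] [Module R M] {N N' : Submodule R M}
    (h : IsSmallSubmodule R M N') (hle : N ≤ N') : IsSmallSubmodule R M N := fun L hL =>
  h L (top_le_iff.mp (hL ▸ sup_le_sup_right hle L))

theorem IsSmallSubmodule.sup {M : Type v} [AddCommGroup M] [Module R M] {N N' : Submodule R M}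
    (h : IsSmallSubmodule R M N) (h' : IsSmallSubmodule R M N') :
    IsSmallSubmodule R M (N ⊔ N') := fun L hL =>
  h' L (h _ (by rw [← sup_assoc]; exact hL))

theorem IsSmallSubmodule.map {M : Type v} [AddCommGroup M] [Module R M] {M' : Type w}
    [AddCommGroup M'] [Module R M'] {N : Submodule R M}
    (h : IsSmallSubmodule R M N) (f : M →ₗ[R] M') : IsSmallSubmodule R M' (N.map f) := by
  intro L hL
  have h1 : L.comap f = ⊤ := by
    apply h
    rw [eq_top_iff]
    intro x _
    have hx : f x ∈ N.map f ⊔ L := hL ▸ Submodule.mem_top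
    obtain ⟨_, ⟨n, hn, rfl⟩, l, hl, hnl⟩ := Submodule.mem_sup.mp hx
    refine Submodule.mem_sup.mpr ⟨n, hn, x - n, ?_, by abel⟩
    have : f (x - n) = l := by rw [map_sub, ← hnl]; abel
    simpa [Submodule.mem_comap, this] using hl
  rw [eq_top_iff, ← hL]
  refine sup_le ?_ le_rfl
  rintro _ ⟨n, -, rfl⟩
  have : n ∈ L.comap f := h1 ▸ Submodule.mem_top
  exact this

theorem small_ker_prodMap {M N S T : Type u} [AddCommGroup M] [Module R M] [AddCommGroup N]
    [Module R N] [AddCommGroup S] [Module R S] [AddCommGroup T] [Module R T]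
    (f : M →ₗ[R] S) (g : N →ₗ[R] T) (hf : IsSmallSubmodule R M (LinearMap.ker f))
    (hg : IsSmallSubmodule R N (LinearMap.ker g)) :
    IsSmallSubmodule R (M × N) (LinearMap.ker (f.prodMap g)) := by
  refine ((hf.map (LinearMap.inl R M N)).sup (hg.map (LinearMap.inr R M N))).mono ?_
  rintro ⟨x, y⟩ hxy
  simp only [LinearMap.mem_ker, LinearMap.prodMap_apply, Prod.mk_eq_zero] at hxy
  exact Submodule.mem_sup.mpr ⟨_, ⟨x, hxy.1, rfl⟩, _, ⟨y, hxy.2, rfl⟩, by simp⟩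

/-- `S` is the image under a small epimorphism of a module with property `Q`. -/
def CoverBy (Q : ∀ (N : Type u) [AddCommGroup N] [Module R N], Prop)
    (S : Type u) [AddCommGroup S] [Module R S] : Prop :=
  ∃ (N : Type u) (_ : AddCommGroup N) (_ : Module R N) (f : N →ₗ[R] S),
    Q N ∧ Function.Surjective f ∧ IsSmallSubmodule R N (LinearMap.ker f)

theorem CoverBy.congr {Q : ∀ (N : Type u) [AddCommGroup N] [Module R N], Prop}
    {S T : Type u} [AddCommGroup S] [Module R S] [AddCommGroup T] [Module R T]
    (h : CoverBy Q S) (e : S ≃ₗ[R] T) : CoverBy Q T := by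
  obtain ⟨N, _, _, f, hQ, hs, hk⟩ := h
  refine ⟨N, _, _, e.toLinearMap ∘ₗ f, hQ, e.surjective.comp hs, hk.mono ?_⟩
  intro x hx
  simpa using hx

theorem CoverBy.prod {Q : ∀ (N : Type u) [AddCommGroup N] [Module R N], Prop}
    (hQ : ∀ (M N : Type u) [AddCommGroup M] [Module R M] [AddCommGroup N] [Module R N],
      Q M → Q N → Q (M × N))
    {S T : Type u} [AddCommGroup S] [Module R S] [AddCommGroup T] [Module R T]
    (h : CoverBy Q S) (h' : CoverBy Q T) : CoverBy Q (S × T) := by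
  obtain ⟨N, _, _, f, hN, hs, hk⟩ := h
  obtain ⟨N', _, _, f', hN', hs', hk'⟩ := h'
  exact ⟨N × N', _, _, f.prodMap f', hQ _ _ hN hN', hs.prodMap hs',
    small_ker_prodMap _ _ hk hk'⟩

theorem CoverBy.pi {Q : ∀ (N : Type u) [AddCommGroup N] [Module R N], Prop}
    (hQ : ∀ (M N : Type u) [AddCommGroup M] [Module R M] [AddCommGroup N] [Module R N],
      Q M → Q N → Q (M × N)) (hQ0 : Q PUnit.{u + 1}) (n : ℕ) :
    ∀ (S : Fin n → Type u) [∀ i, AddCommGroup (S i)] [∀ i, Module R (S i)],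
    (∀ i, CoverBy Q (S i)) → CoverBy Q (∀ i, S i) := by
  induction n with
  | zero =>
    intro S _ _ _
    refine ⟨PUnit, _, _, 0, hQ0, fun x => ⟨0, Subsingleton.elim _ _⟩, fun L _ => ?_⟩
    exact Subsingleton.elim _ _
  | succ n ih =>
    intro S _ _ h
    exact (CoverBy.prod hQ (h 0) (ih _ fun i => h i.succ)).congr (Fin.consLinearEquiv R S)

theorem CoverBy.semisimple {Q : ∀ (N : Type u) [AddCommGroup N] [Module R N], Prop}
    (hQ : ∀ (M N : Type u) [AddCommGroup M] [Module R M] [AddCommGroup N] [Module R N],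
      Q M → Q N → Q (M × N)) (hQ0 : Q PUnit.{u + 1})
    (hS : ∀ (S : Type u) [AddCommGroup S] [Module R S], IsSimpleModule R S → CoverBy Q S)
    (T : Type u) [AddCommGroup T] [Module R T] [IsSemisimpleModule R T] [Module.Finite R T] :
    CoverBy Q T := by
  obtain ⟨n, S, e, h⟩ := IsSemisimpleModule.exists_linearEquiv_fin_dfinsupp R T
  exact (CoverBy.pi hQ hQ0 n (fun i => S i) fun i => hS _ (h i)).congr
    (e.trans DFinsupp.linearEquivFunOnFintype).symm

theorem flat_prod (M N : Type u) [AddCommGroup M] [Module R M] [AddCommGroup N] [Module R N]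
    (hM : IsFlatModule R M) (hN : IsFlatModule R N) : IsFlatModule R (M × N) := by
  intro n a m hm
  have h1 : ∑ i, a i • (m i).1 = 0 := by simpa [Prod.fst_sum] using congrArg Prod.fst hm
  have h2 : ∑ i, a i • (m i).2 = 0 := by simpa [Prod.snd_sum] using congrArg Prod.snd hm
  obtain ⟨k, b, y, hb, hy⟩ := hM n a _ h1
  obtain ⟨k', b', y', hb', hy'⟩ := hN n a _ h2
  refine ⟨k + k', fun i => Fin.append (b i) (b' i),
    Fin.append (fun j => (y j, 0)) (fun j => (0, y' j)), fun i => ?_, fun j => ?_⟩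
  · ext
    · simp [Fin.sum_univ_add, Prod.fst_sum, hb i]
    · simp [Fin.sum_univ_add, Prod.snd_sum, hb' i]
  · refine Fin.addCases (fun j => ?_) (fun j => ?_) j
    · simpa using hy j
    · simpa using hy' j

theorem flat_of_projective (P : Type u) [AddCommGroup P] [Module R P] [Module.Projective R P] :
    IsFlatModule R P := by
  classical
  obtain ⟨s, hs⟩ := Module.projective_def'.mp (‹Module.Projective R P›)
  intro n a m hm
  let F : Finset P := Finset.univ.biUnion fun i => (s (m i)).support
  let e := F.equivFin
  refine ⟨F.card, fun i j => s (m i) (e.symm j), fun j => e.symm j, fun i => ?_, fun j => ?_⟩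
  · have h1 : Finsupp.linearCombination R id (s (m i)) = m i := LinearMap.congr_fun hs (m i)
    rw [Finsupp.linearCombination_apply, Finsupp.sum_of_support_subset (s := F)] at h1
    · rw [e.symm.sum_comp (fun p : F => s (m i) p • (p : P)),
        Finset.sum_coe_sort F (fun p => s (m i) p • p)]
      exact h1.symm
    · exact Finset.subset_biUnion_of_mem (fun i => (s (m i)).support) (Finset.mem_univ i)
    · simp
  · have := congrArg (fun p => s p (e.symm j : P)) hm
    simpa [Finsupp.finsetSum_apply] using this

theorem flat_punit : IsFlatModule R PUnit.{u + 1} := flat_of_projective _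

theorem mul_right_mem_rad {x : R} (hx : x ∈ moduleRad R R) (b : R) : x * b ∈ moduleRad R R :=
  Module.le_comap_jacobson (f := LinearMap.toSpanSingleton R R b) hx

theorem mul_left_mem_rad {x : R} (hx : x ∈ moduleRad R R) (b : R) : b * x ∈ moduleRad R R :=
  (moduleRad R R).smul_mem b hx

theorem exists_left_inv {u : R} (hu : u ∈ moduleRad R R) : ∃ v, v * (1 - u) = 1 := by
  have h : Submodule.span R {1 - u} = (⊤ : Submodule R R) := by
    apply small_rad R
    rw [eq_top_iff]
    intro x _
    refine Submodule.mem_sup.mpr ⟨x * u, mul_left_mem_rad hu x, x * (1 - u),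
      Submodule.mem_span_singleton.mpr ⟨x, rfl⟩, by rw [mul_sub, mul_one]; abel⟩
  have h1 : (1 : R) ∈ Submodule.span R {1 - u} := h ▸ Submodule.mem_top
  exact Submodule.mem_span_singleton.mp h1

theorem exists_right_inv {u : R} (hu : u ∈ moduleRad R R) : ∃ v, (1 - u) * v = 1 := by
  obtain ⟨v, hv⟩ := exists_left_inv hu
  have hw : -(v * u) ∈ moduleRad R R := neg_mem (mul_left_mem_rad hu v)
  obtain ⟨w, hw⟩ := exists_left_inv hw
  have h1 : 1 - -(v * u) = v := by rw [← hv]; noncomm_ring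
  rw [h1] at hw
  have : w = 1 - u := by
    calc w = w * (v * (1 - u)) := by rw [hv, mul_one]
      _ = 1 - u := by rw [← mul_assoc, hw, one_mul]
  exact ⟨v, this ▸ hw⟩

/-- Key step: flat covers of simple modules give lifting of idempotents. -/
theorem lift_of_flat (hR : IsSemilocalModule R R)
    (hS : ∀ (S : Type u) [AddCommGroup S] [Module R S], IsSimpleModule R S →
      CoverBy (fun (N : Type u) [AddCommGroup N] [Module R N] => IsFlatModule R N) S)
    (a : R) (ha : a * a - a ∈ moduleRad R R) :
    ∃ e : R, e * e = e ∧ e - a ∈ moduleRad R R := by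
  have : IsSemisimpleModule R (R ⧸ moduleRad R R) := hR
  let π := (moduleRad R R).mkQ
  have hπ : ∀ x, π x = 0 ↔ x ∈ moduleRad R R := fun x => Submodule.Quotient.mk_eq_zero _
  obtain ⟨P, _, _, f, hP, hfs, hfk⟩ := CoverBy.semisimple
    (fun M N _ _ _ _ => flat_prod (R := R) M N) flat_punit hS (Submodule.span R {π a})
  obtain ⟨P', _, _, g, hP', hgs, hgk⟩ := CoverBy.semisimple
    (fun M N _ _ _ _ => flat_prod (R := R) M N) flat_punit hS (Submodule.span R {π (1 - a)})
  obtain ⟨p, hp⟩ := hfs ⟨π a, Submodule.mem_span_singleton_self _⟩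
  obtain ⟨q, hq⟩ := hgs ⟨π (1 - a), Submodule.mem_span_singleton_self _⟩
  have hflat := flat_prod (R := R) P P' hP hP'
  have hsm := small_ker_prodMap f g hfk hgk
  have hpr : ∀ r : R, (f (r • p) : R ⧸ moduleRad R R) = π (r * a) := by
    intro r; rw [map_smul, hp]; rfl
  have hqr : ∀ r : R, (g (r • q) : R ⧸ moduleRad R R) = π (r * (1 - a)) := by
    intro r; rw [map_smul, hq]; rfl
  -- surjectivity
  have htop : Submodule.span R {(p, q)} = (⊤ : Submodule R (P × P')) := by
    apply hsm
    rw [eq_top_iff]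
    rintro ⟨x, y⟩ -
    obtain ⟨r, hr⟩ := Submodule.mem_span_singleton.mp (f x).2
    obtain ⟨s, hs⟩ := Submodule.mem_span_singleton.mp (g y).2
    let t := r * a + s * (1 - a)
    refine Submodule.mem_sup.mpr ⟨(x, y) - t • (p, q), ?_, t • (p, q),
      Submodule.mem_span_singleton.mpr ⟨t, rfl⟩, by abel⟩
    have e1 : t * a - r * a ∈ moduleRad R R := by
      have : t * a - r * a = (r - s) * (a * a - a) := by simp only [t]; noncomm_ring
      rw [this]; exact mul_left_mem_rad ha _
    have e2 : t * (1 - a) - s * (1 - a) ∈ moduleRad R R := by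
      have : t * (1 - a) - s * (1 - a) = (s - r) * (a * a - a) := by simp only [t]; noncomm_ring
      rw [this]; exact mul_left_mem_rad ha _
    rw [← hπ, map_sub, sub_eq_zero] at e1 e2
    refine LinearMap.mem_ker.mpr (((f.prodMap g).map_sub _ _).trans (sub_eq_zero.mpr ?_))
    refine Prod.ext (Subtype.ext ?_) (Subtype.ext ?_)
    · change (f x : R ⧸ moduleRad R R) = f (t • p)
      rw [hpr, ← hr, e1]; rfl
    · change (g y : R ⧸ moduleRad R R) = g (t • q)
      rw [hqr, ← hs, e2]; rfl
  have hsurj : ∀ z : P × P', ∃ r : R, r • (p, q) = z := fun z =>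
    Submodule.mem_span_singleton.mp (htop ▸ Submodule.mem_top)
  have hker : ∀ r : R, r • (p, q) = 0 → r ∈ moduleRad R R := by
    intro r hr
    have h1 : r • p = 0 := congrArg Prod.fst hr
    have h2 : r • q = 0 := congrArg Prod.snd hr
    have h3 := hpr r
    have h4 := hqr r
    rw [h1, map_zero, Submodule.coe_zero] at h3
    rw [h2, map_zero, Submodule.coe_zero] at h4
    have := add_mem ((hπ _).mp h3.symm) ((hπ _).mp h4.symm)
    rwa [← mul_add, add_sub_cancel, mul_one] at this
  have hinj : ∀ r : R, r • (p, q) = 0 → r = 0 := by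
    intro r hr
    obtain ⟨k, b, y, hb, hy⟩ := hflat 1 (fun _ => r) (fun _ => (p, q)) (by simpa using hr)
    choose c hc using fun j => hsurj (y j)
    have hb0 := hb 0
    let w := ∑ j, b 0 j * c j
    have hw : w • (p, q) = (p, q) := by
      have h1 : (p, q) = ∑ j, (b 0 j * c j) • (p, q) :=
        hb0.trans (Finset.sum_congr rfl fun j _ => by rw [mul_smul, hc j])
      rw [← Finset.sum_smul] at h1
      exact h1.symm
    have hu : 1 - w ∈ moduleRad R R := hker _ (by rw [sub_smul, one_smul, hw, sub_self])
    obtain ⟨v, hv⟩ := exists_right_inv hu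
    rw [sub_sub_cancel] at hv
    have hrw : r * w = 0 := by
      simp only [w, Finset.mul_sum]
      refine Finset.sum_eq_zero fun j _ => ?_
      have := hy j
      simp only [Finset.univ_unique, Finset.sum_singleton] at this
      rw [← mul_assoc]
      erw [this]
      rw [zero_mul]
    rw [← mul_one r, ← hv, ← mul_assoc, hrw, zero_mul]
  obtain ⟨e, he⟩ := hsurj (p, 0)
  have he1 : e • p = p := congrArg Prod.fst he
  have he2 : e • q = 0 := congrArg Prod.snd he
  refine ⟨e, ?_, ?_⟩
  · rw [← sub_eq_zero]
    apply hinj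
    rw [sub_smul, mul_smul, he, Prod.smul_mk, he1, smul_zero, sub_self]
  · have h3 := hpr e
    have h4 := hqr e
    rw [he1, hp] at h3
    rw [he2, map_zero, Submodule.coe_zero] at h4
    have h5 : e * a - a ∈ moduleRad R R := by
      rw [← hπ, map_sub, sub_eq_zero]; exact h3.symm
    have := add_mem h5 ((hπ _).mp h4.symm)
    convert this using 1
    noncomm_ring

/-- Over a semiperfect ring simple modules have projective covers. -/
theorem proj_cover_simple (hR : IsSemiperfectRing' R) (S : Type u) [AddCommGroup S] [Module R S]
    (hS : IsSimpleModule R S) :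
    CoverBy (fun (N : Type u) [AddCommGroup N] [Module R N] => Module.Projective R N) S := by
  have hss : IsSemisimpleModule R (R ⧸ moduleRad R R) := hR.1
  have := IsSimpleModule.nontrivial R S
  obtain ⟨s, hs⟩ := exists_ne (0 : S)
  let φ := LinearMap.toSpanSingleton R S s
  have hφ : ∀ r, φ r = r • s := fun r => rfl
  let K := LinearMap.ker φ
  have hK : moduleRad R R ≤ K := sInf_le (IsSimpleModule.ker_toSpanSingleton_isMaximal R hs).1
  let π := (moduleRad R R).mkQ
  have hπ : ∀ x, π x = 0 ↔ x ∈ moduleRad R R := fun x => Submodule.Quotient.mk_eq_zero _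
  obtain ⟨L', hL'⟩ := exists_isCompl (K.map π)
  have hKL : ∀ x, x ∈ K → π x ∈ L' → x ∈ moduleRad R R := by
    intro x hx hxL
    rw [← hπ]
    exact (Submodule.disjoint_def.mp hL'.disjoint) _ ⟨x, hx, rfl⟩ hxL
  have h1 : π 1 ∈ K.map π ⊔ L' := hL'.sup_eq_top ▸ Submodule.mem_top
  obtain ⟨_, ⟨k, hk, rfl⟩, l, hl, hkl⟩ := Submodule.mem_sup.mp h1
  let a := 1 - k
  have haL : π a ∈ L' := by
    have : π a = l := by simp only [a]; rw [map_sub, ← hkl]; abel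
    rwa [this]
  have haa : a * a - a ∈ moduleRad R R := by
    apply hKL
    · have : a * a - a = (-a) • k := by simp only [a, smul_eq_mul]; noncomm_ring
      rw [this]; exact K.smul_mem _ hk
    · rw [map_sub]
      refine sub_mem ?_ haL
      have : π (a * a) = a • π a := rfl
      rw [this]; exact L'.smul_mem _ haL
  obtain ⟨e, hee, hea⟩ := hR.2 a haa
  have hpe : π e = π a := by rw [← sub_eq_zero, ← map_sub, hπ]; exact hea
  have hes : e • s = s := by
    have h2 : φ (e - a) = 0 := hK hea
    have h3 : φ k = 0 := hk
    have : e = (e - a) + 1 - k := by simp only [a]; abel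
    rw [← hφ, this, map_sub, map_add, h2, h3, hφ]; simp
  let P := LinearMap.range (LinearMap.toSpanSingleton R R e)
  have hPe : ∀ x : P, (x : R) * e = x := by
    rintro ⟨_, r, rfl⟩
    simp [mul_assoc, hee]
  have hproj : Module.Projective R P := by
    refine Module.Projective.of_split P.subtype (LinearMap.toSpanSingleton R R e).rangeRestrict ?_
    ext x
    simpa using hPe x
  refine ⟨P, _, _, φ ∘ₗ P.subtype, hproj, ?_, ?_⟩
  · intro t
    obtain ⟨r, hr⟩ := IsSimpleModule.toSpanSingleton_surjective R hs t
    refine ⟨⟨r * e, r, rfl⟩, ?_⟩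
    change (r * e) • s = t
    rw [mul_smul, hes]; exact hr
  · intro X hX
    have hJ : ∀ x : P, x ∈ LinearMap.ker (φ ∘ₗ P.subtype) → (x : R) ∈ moduleRad R R := by
      intro x hx
      apply hKL _ hx
      change π (x : R) ∈ L'
      rw [← hPe x]
      have : π ((x : R) * e) = (x : R) • π e := rfl
      rw [this, hpe]; exact L'.smul_mem _ haL
    have htop : X.map P.subtype ⊔ Submodule.span R {1 - e} = ⊤ := by
      apply small_rad R
      rw [eq_top_iff]
      intro r _
      have : (⟨r * e, r, rfl⟩ : P) ∈ LinearMap.ker (φ ∘ₗ P.subtype) ⊔ X := hX ▸ Submodule.mem_top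
      obtain ⟨y, hy, x, hx, hyx⟩ := Submodule.mem_sup.mp this
      refine Submodule.mem_sup.mpr ⟨y, hJ y hy, x + r * (1 - e), ?_, ?_⟩
      · exact Submodule.mem_sup.mpr ⟨x, ⟨x, hx, rfl⟩, _,
          Submodule.mem_span_singleton.mpr ⟨r, rfl⟩, rfl⟩
      · have : (y : R) + x = r * e := congrArg Subtype.val hyx
        rw [← add_assoc, this]; noncomm_ring
    rw [eq_top_iff]
    intro z _
    have hz : (z : R) ∈ X.map P.subtype ⊔ Submodule.span R {1 - e} := htop ▸ Submodule.mem_top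
    obtain ⟨_, ⟨x, hx, rfl⟩, l, hl, hxl⟩ := Submodule.mem_sup.mp hz
    obtain ⟨r, rfl⟩ := Submodule.mem_span_singleton.mp hl
    have : z = x := by
      apply Subtype.ext
      rw [← hPe z, ← hxl, add_mul, P.subtype_apply, hPe x, smul_eq_mul, mul_assoc, sub_mul, hee]
      simp
    rwa [this]

theorem semisimple_quot_rad (hR : IsSemilocalModule R R) (M : Type u) [AddCommGroup M]
    [Module R M] : IsSemisimpleModule R (M ⧸ moduleRad R M) := by
  have hss : IsSemisimpleModule R (R ⧸ moduleRad R R) := hR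
  let T := M ⧸ moduleRad R M
  have hT : Module.jacobson R T = ⊥ := Module.jacobson_quotient_jacobson R M
  refine isSemisimpleModule_of_isSemisimpleModule_submodule'
    (p := fun t : T => LinearMap.range (LinearMap.toSpanSingleton R T t)) (fun t => ?_) ?_
  · have hle : moduleRad R R ≤ LinearMap.ker (LinearMap.toSpanSingleton R T t) := by
      have := Module.le_comap_jacobson (LinearMap.toSpanSingleton R T t)
      rwa [hT, Submodule.comap_bot] at this
    have := IsSemisimpleModule.range
      ((moduleRad R R).liftQ (LinearMap.toSpanSingleton R T t) hle)
    rwa [Submodule.range_liftQ] at this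
  · rw [eq_top_iff]
    intro t _
    exact Submodule.mem_iSup_of_mem t ⟨1, by simp⟩

theorem flat_cover_of_semiperfect (hR : IsSemiperfectRing' R) (M : Type u) [AddCommGroup M]
    [Module R M] [Module.Finite R M] : Nonempty (FlatCover R M) := by
  have := semisimple_quot_rad hR.1 M
  obtain ⟨P, _, _, f, hP, hfs, hfk⟩ := CoverBy.semisimple
    (Q := fun (N : Type u) [AddCommGroup N] [Module R N] => Module.Projective R N)
    (fun M N _ _ _ _ h h' => by have := h; have := h'; infer_instance)
    inferInstance (proj_cover_simple hR) (M ⧸ moduleRad R M)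
  have := hP
  obtain ⟨g, hg⟩ := Module.projective_lifting_property (moduleRad R M).mkQ f
    (Submodule.mkQ_surjective _)
  have hg' : ∀ x, (moduleRad R M).mkQ (g x) = f x := LinearMap.congr_fun hg
  refine ⟨{ N := P, flat := flat_of_projective P, f := g, surj := ?_, small := hfk.mono ?_ }⟩
  · rw [← LinearMap.range_eq_top]
    apply small_rad M
    rw [eq_top_iff]
    intro m _
    obtain ⟨x, hx⟩ := hfs ((moduleRad R M).mkQ m)
    refine Submodule.mem_sup.mpr ⟨m - g x, ?_, g x, ⟨x, rfl⟩, by abel⟩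
    rw [← Submodule.Quotient.mk_eq_zero, ← Submodule.mkQ_apply, map_sub, hg', hx, sub_self]
  · intro x hx
    rw [LinearMap.mem_ker] at hx ⊢
    rw [← hg', hx, map_zero]

theorem semiperfect_of_flat (hR : IsSemilocalModule R R)
    (h : ∀ (S : Type u) [AddCommGroup S] [Module R S],
      IsSimpleModule R S → Nonempty (FlatCover R S)) : IsSemiperfectRing' R := by
  refine ⟨hR, lift_of_flat hR fun S _ _ hS => ?_⟩
  obtain ⟨c⟩ := h S hS
  exact ⟨c.N, c.nAdd, c.nMod, c.f, c.flat, c.surj, c.small⟩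

end Helpers

/-- `R` is semiperfect iff `R` is semilocal and every simple left
`R`-module has a flat cover, iff `R` is semilocal and every finitely generated
left `R`-module has a flat cover. -/
theorem semiperfect_iff_semilocal_and_flat_covers (R : Type u) [Ring R] :
    (IsSemiperfectRing' R ↔
      (IsSemilocalModule R R ∧
        ∀ (S : Type u) [AddCommGroup S] [Module R S],
          IsSimpleModule R S → Nonempty (FlatCover R S))) ∧
    (IsSemiperfectRing' R ↔
      (IsSemilocalModule R R ∧
        ∀ (S : Type u) [AddCommGroup S] [Module R S] [Module.Finite R S],
          Nonempty (FlatCover R S))) := by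
  exact ⟨⟨fun h => ⟨h.1, fun S _ _ hS => flat_cover_of_semiperfect h S⟩,
      fun h => semiperfect_of_flat h.1 h.2⟩,
    ⟨fun h => ⟨h.1, fun S _ _ _ => flat_cover_of_semiperfect h S⟩,
      fun h => semiperfect_of_flat h.1 fun S _ _ hS => h.2 S⟩⟩
end
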